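/- arXiv:0911.3919 — 3 statements merged into one kernel-verified Lean document; each statement's English description precedes it below -/
import Mathlib

section
/- Let K₋° = {x ∈ V : [x, x] < 0 and x₀ < 0}. Then K₋° is the disjoint union of the sets (−1 − w)(C°) = {−x − w x : x ∈ C°} over w ∈ W: each −x − w x with x ∈ C° lies in K₋°; every u ∈ K₋° equals −x − w x for some w ∈ W and x ∈ C°; and for distinct w, w' ∈ W the sets (−1 − w)(C°) and (−1 − w')(C°) are disjoint. -/
noncomputable section

/-- The Minkowski bilinear form `[x, y] = -x₀y₀ + x₁y₁ + ⋯ + xₙyₙ` on `ℝ^{n+1}`. -/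
def mink {n : ℕ} (x y : Fin (n + 1) → ℝ) : ℝ :=
  -(x 0 * y 0) + ∑ i : Fin n, x i.succ * y i.succ

/-- The hyperboloid model of hyperbolic `n`-space: `{x | [x, x] = -1, x₀ > 0}`. -/
def hypSpace (n : ℕ) : Set (Fin (n + 1) → ℝ) :=
  {x | mink x x = -1 ∧ 0 < x 0}

/-- `g` is the Minkowski reflection `x ↦ x - 2([x, e]/[e, e]) e` in a vector `e` with
`[e, e] > 0`. -/
def IsMinkRefl {n : ℕ} (g : (Fin (n + 1) → ℝ) ≃ₗ[ℝ] (Fin (n + 1) → ℝ)) : Prop :=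
  ∃ e : Fin (n + 1) → ℝ, 0 < mink e e ∧ ∀ x, g x = x - ((2 * mink x e) / mink e e) • e

/-- The union of the reflection hyperplanes (mirrors) of the Minkowski reflections
belonging to `W`; the mirror of a reflection is exactly its set of fixed points. -/
def minkMirrors {n : ℕ} (W : Subgroup ((Fin (n + 1) → ℝ) ≃ₗ[ℝ] (Fin (n + 1) → ℝ))) :
    Set (Fin (n + 1) → ℝ) :=
  ⋃ g ∈ {g : (Fin (n + 1) → ℝ) ≃ₗ[ℝ] (Fin (n + 1) → ℝ) | g ∈ W ∧ IsMinkRefl g},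
    {x : Fin (n + 1) → ℝ | g x = x}


section Basic
open Set Filter Topology
variable {n : ℕ}

lemma mink_comm (x y : Fin (n + 1) → ℝ) : mink x y = mink y x := by
  simp [mink, mul_comm]

lemma mink_add_left (x y z : Fin (n + 1) → ℝ) : mink (x + y) z = mink x z + mink y z := by
  simp [mink, add_mul, Finset.sum_add_distrib]; ring

lemma mink_smul_left (a : ℝ) (x z : Fin (n + 1) → ℝ) : mink (a • x) z = a * mink x z := by
  simp [mink, mul_add, Finset.mul_sum, mul_assoc]

lemma mink_add_right (x y z : Fin (n + 1) → ℝ) : mink z (x + y) = mink z x + mink z y := by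
  rw [mink_comm, mink_add_left, mink_comm x, mink_comm y]

lemma mink_smul_right (a : ℝ) (x z : Fin (n + 1) → ℝ) : mink z (a • x) = a * mink z x := by
  rw [mink_comm, mink_smul_left, mink_comm x]

lemma mink_neg_left (x z : Fin (n + 1) → ℝ) : mink (-x) z = - mink x z := by
  rw [← neg_one_smul ℝ x, mink_smul_left]; ring

lemma mink_neg_right (x z : Fin (n + 1) → ℝ) : mink z (-x) = - mink z x := by
  rw [mink_comm, mink_neg_left, mink_comm x]

lemma mink_sub_left (x y z : Fin (n + 1) → ℝ) : mink (x - y) z = mink x z - mink y z := by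
  rw [sub_eq_add_neg, mink_add_left, mink_neg_left]; ring

lemma mink_sub_right (x y z : Fin (n + 1) → ℝ) : mink z (x - y) = mink z x - mink z y := by
  rw [sub_eq_add_neg, mink_add_right, mink_neg_right]; ring

lemma mink_zero_left (z : Fin (n + 1) → ℝ) : mink 0 z = 0 := by simp [mink]

lemma mink_zero_right (z : Fin (n + 1) → ℝ) : mink z 0 = 0 := by simp [mink]

lemma mink_sum_left {ι : Type*} (s : Finset ι) (f : ι → Fin (n + 1) → ℝ) (z : Fin (n + 1) → ℝ) :
    mink (∑ i ∈ s, f i) z = ∑ i ∈ s, mink (f i) z := by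
  classical
  induction s using Finset.induction_on with
  | empty => simp [mink_zero_left]
  | insert a s ha ih => rw [Finset.sum_insert ha, Finset.sum_insert ha, mink_add_left, ih]

lemma continuous_mink : Continuous (fun q : (Fin (n + 1) → ℝ) × (Fin (n + 1) → ℝ) =>
    mink q.1 q.2) := by
  unfold mink; fun_prop

lemma Continuous.mink {X : Type*} [TopologicalSpace X] {f g : X → Fin (n + 1) → ℝ}
    (hf : Continuous f) (hg : Continuous g) : Continuous (fun x => mink (f x) (g x)) :=
  continuous_mink.comp (hf.prodMk hg)

/-- open forward time cone -/
def Tm (n : ℕ) : Set (Fin (n + 1) → ℝ) := {v | mink v v < 0 ∧ 0 < v 0}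

lemma isOpen_Tm : IsOpen (Tm n) := by
  have h1 : Continuous (fun v : Fin (n + 1) → ℝ => mink v v) := continuous_id.mink continuous_id
  have h2 : Continuous (fun v : Fin (n + 1) → ℝ => v 0) := by fun_prop
  exact (isOpen_lt h1 continuous_const).inter (isOpen_lt continuous_const h2)

lemma hyp_sub_Tm {x : Fin (n + 1) → ℝ} (hx : x ∈ hypSpace n) : x ∈ Tm n :=
  ⟨by rw [hx.1]; norm_num, hx.2⟩

lemma Tm_smul {x : Fin (n + 1) → ℝ} (hx : x ∈ Tm n) {a : ℝ} (ha : 0 < a) : a • x ∈ Tm n := by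
  refine ⟨?_, by simpa using mul_pos ha hx.2⟩
  rw [mink_smul_left, mink_smul_right]
  have := hx.1
  exact mul_neg_of_pos_of_neg ha (mul_neg_of_pos_of_neg ha this)

lemma sum_cs (x y : Fin (n + 1) → ℝ) : (∑ i : Fin n, x i.succ * y i.succ) ^ 2 ≤
    (∑ i : Fin n, x i.succ * x i.succ) * (∑ i : Fin n, y i.succ * y i.succ) := by
  have := Finset.sum_mul_sq_le_sq_mul_sq Finset.univ (fun i : Fin n => x i.succ)
    (fun i : Fin n => y i.succ)
  simpa [pow_two] using this

lemma sum_nn (x : Fin (n + 1) → ℝ) : 0 ≤ ∑ i : Fin n, x i.succ * x i.succ :=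
  Finset.sum_nonneg fun _ _ => mul_self_nonneg _

lemma mink_neg_of_Tm {x y : Fin (n + 1) → ℝ} (hx : x ∈ Tm n) (hy : y ∈ Tm n) :
    mink x y < 0 := by
  have h := sum_cs x y
  have hx1 := hx.1
  have hy1 := hy.1
  have hx2 := hx.2
  have hy2 := hy.2
  unfold mink at *
  have a := sum_nn x
  have b := sum_nn y
  set X := ∑ i : Fin n, x i.succ * x i.succ
  set Y := ∑ i : Fin n, y i.succ * y i.succ
  set S := ∑ i : Fin n, x i.succ * y i.succ
  have : S ^ 2 < (x 0 * y 0) ^ 2 := by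
    have : X * Y < (x 0 * x 0) * (y 0 * y 0) := by
      have h0 : 0 < x 0 * x 0 := by positivity
      apply mul_lt_mul'' <;> linarith
    nlinarith
  have := abs_lt_of_sq_lt_sq this (by positivity)
  have := (abs_lt.1 this).2
  linarith

lemma Tm_add {x y : Fin (n + 1) → ℝ} (hx : x ∈ Tm n) (hy : y ∈ Tm n) : x + y ∈ Tm n := by
  have := mink_neg_of_Tm hx hy
  refine ⟨?_, by simpa using add_pos hx.2 hy.2⟩
  rw [mink_add_left, mink_add_right, mink_add_right, mink_comm y x]
  linarith [hx.1, hy.1]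

lemma Tm_of_mink {v x : Fin (n + 1) → ℝ} (hv : mink v v < 0) (hx : x ∈ Tm n)
    (h : mink v x < 0) : v ∈ Tm n := by
  refine ⟨hv, ?_⟩
  by_contra h0
  have h1 : v 0 ≠ 0 := by
    intro h1
    have := sum_nn v
    unfold mink at hv
    rw [h1] at hv
    linarith
  have h2 : v 0 < 0 := lt_of_le_of_ne (not_lt.1 h0) h1
  have : -v ∈ Tm n := ⟨by rw [mink_neg_left, mink_neg_right]; linarith, by simpa using h2⟩
  have := mink_neg_of_Tm this hx
  rw [mink_neg_left] at this
  linarith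

lemma mink_pos_of_orth {x t : Fin (n + 1) → ℝ} (hx : mink x x < 0) (ht : mink x t = 0)
    (h0 : t ≠ 0) : 0 < mink t t := by
  have h := sum_cs x t
  have a := sum_nn x
  have b := sum_nn t
  have hb : (∑ i : Fin n, t i.succ * t i.succ) = 0 → ∀ i : Fin n, t i.succ = 0 := by
    intro h i
    have := (Finset.sum_eq_zero_iff_of_nonneg (fun i _ => mul_self_nonneg _)).1 h i
      (Finset.mem_univ i)
    simpa using this
  unfold mink at *
  set X := ∑ i : Fin n, x i.succ * x i.succ
  set Y := ∑ i : Fin n, t i.succ * t i.succ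
  set S := ∑ i : Fin n, x i.succ * t i.succ
  have hS : S = x 0 * t 0 := by linarith
  rw [hS] at h
  have hx0 : 0 < x 0 * x 0 := by linarith
  by_contra hneg
  have h1 : Y ≤ t 0 * t 0 := by linarith
  rcases eq_or_lt_of_le (mul_self_nonneg (t 0)) with h2 | h2
  · apply h0
    have hY : Y = 0 := by linarith
    have h3 := hb hY
    funext i
    refine Fin.cases ?_ (fun i => ?_) i
    · simpa using h2.symm
    · simpa using h3 i
  · have h3 : X * Y ≤ X * (t 0 * t 0) := mul_le_mul_of_nonneg_left h1 a
    have h4 : X * (t 0 * t 0) < (x 0 * x 0) * (t 0 * t 0) :=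
      mul_lt_mul_of_pos_right (by linarith) h2
    nlinarith

lemma mink_nonneg_of_orth {x t : Fin (n + 1) → ℝ} (hx : mink x x < 0) (ht : mink x t = 0) :
    0 ≤ mink t t := by
  by_cases h : t = 0
  · simp [h, mink_zero_left]
  · exact (mink_pos_of_orth hx ht h).le

lemma cs_orth {p a b : Fin (n + 1) → ℝ} (hp : mink p p < 0) (ha : mink p a = 0)
    (hb : mink p b = 0) : (mink a b) ^ 2 ≤ mink a a * mink b b := by
  by_cases h : b = 0
  · simp [h, mink_zero_right]
  have hY := mink_pos_of_orth hp hb h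
  have hz : mink p (mink b b • a - mink a b • b) = 0 := by
    rw [mink_sub_right, mink_smul_right, mink_smul_right, ha, hb]; ring
  have := mink_nonneg_of_orth hp hz
  simp only [mink_sub_right, mink_smul_right, mink_sub_left, mink_smul_left, mink_comm b a] at this
  have h2 : 0 ≤ mink b b * (mink a a * mink b b - mink a b ^ 2) := by nlinarith
  have := nonneg_of_mul_nonneg_right h2 hY
  linarith

lemma hyp_mink_le {x y : Fin (n + 1) → ℝ} (hx : x ∈ hypSpace n) (hy : y ∈ hypSpace n) :
    mink x y ≤ -1 := by
  have hneg := mink_neg_of_Tm (hyp_sub_Tm hx) (hyp_sub_Tm hy)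
  have ht : mink x (y + mink x y • x) = 0 := by
    rw [mink_add_right, mink_smul_right, hx.1]; ring
  have := mink_nonneg_of_orth (hyp_sub_Tm hx).1 ht
  simp only [mink_add_right, mink_smul_right, mink_add_left, mink_smul_left, mink_comm y x,
    hx.1, hy.1] at this
  nlinarith

lemma hyp_mink_lt {x y : Fin (n + 1) → ℝ} (hx : x ∈ hypSpace n) (hy : y ∈ hypSpace n)
    (hxy : x ≠ y) : mink x y < -1 := by
  refine lt_of_le_of_ne (hyp_mink_le hx hy) fun h => ?_
  have ht : mink x (y - x) = 0 := by rw [mink_sub_right, h, hx.1]; ring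
  have := mink_pos_of_orth (hyp_sub_Tm hx).1 ht (sub_ne_zero.2 hxy.symm)
  simp only [mink_sub_right, mink_sub_left, mink_comm y x, hx.1, hy.1, h] at this
  linarith

lemma gram {x y p : Fin (n + 1) → ℝ} (hx : x ∈ hypSpace n) (hy : y ∈ hypSpace n)
    (hp : p ∈ hypSpace n) : (mink x p) ^ 2 + (mink y p) ^ 2 + (mink x y) ^ 2 ≤
      1 - 2 * (mink x p * mink y p * mink x y) := by
  have h1 : mink p (x + mink x p • p) = 0 := by
    rw [mink_add_right, mink_smul_right, hp.1, mink_comm p x]; ring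
  have h2 : mink p (y + mink y p • p) = 0 := by
    rw [mink_add_right, mink_smul_right, hp.1, mink_comm p y]; ring
  have := cs_orth (hyp_sub_Tm hp).1 h1 h2
  simp only [mink_add_right, mink_smul_right, mink_add_left, mink_smul_left, mink_comm p y,
    mink_comm p x, hx.1, hy.1, hp.1] at this
  nlinarith

/-- normalization -/
def nrm (v : Fin (n + 1) → ℝ) : Fin (n + 1) → ℝ := (√|mink v v|)⁻¹ • v

lemma nrm_mem {v : Fin (n + 1) → ℝ} (hv : v ∈ Tm n) : nrm v ∈ hypSpace n := by
  have h1 := hv.1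
  have h : 0 < √|mink v v| := Real.sqrt_pos.2 (abs_pos.2 h1.ne)
  refine ⟨?_, ?_⟩
  · unfold nrm
    rw [mink_smul_left, mink_smul_right, ← mul_assoc, ← mul_inv, Real.mul_self_sqrt (abs_nonneg _),
      abs_of_neg h1, inv_neg, neg_mul, inv_mul_cancel₀ h1.ne]
  · simpa [nrm] using mul_pos (inv_pos.2 h) hv.2

lemma nrm_mink_one {v : Fin (n + 1) → ℝ} (hv : 0 < mink v v) : mink (nrm v) (nrm v) = 1 := by
  unfold nrm
  rw [mink_smul_left, mink_smul_right, ← mul_assoc, ← mul_inv, Real.mul_self_sqrt (abs_nonneg _),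
      abs_of_pos hv]
  field_simp

lemma nrm_pos {v : Fin (n + 1) → ℝ} (hv : mink v v ≠ 0) : 0 < (√|mink v v|)⁻¹ :=
  inv_pos.2 (Real.sqrt_pos.2 (abs_pos.2 hv))

lemma nrm_eq_self {v : Fin (n + 1) → ℝ} (hv : |mink v v| = 1) : nrm v = v := by
  simp [nrm, hv]

lemma nrm_cont : ContinuousOn (nrm : (Fin (n + 1) → ℝ) → _) {v | mink v v ≠ 0} := by
  unfold nrm
  have h : Continuous (fun v : Fin (n + 1) → ℝ => √|mink v v|) :=
    (continuous_id.mink continuous_id).abs.sqrt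
  exact (h.continuousOn.inv₀ fun v hv => (Real.sqrt_pos.2 (abs_pos.2 hv)).ne').smul
    continuousOn_id

lemma isClosed_hyp : IsClosed (hypSpace n) := by
  have : hypSpace n = {x | mink x x = -1 ∧ 0 ≤ x 0} := by
    ext x
    refine ⟨fun h => ⟨h.1, h.2.le⟩, fun h => ⟨h.1, lt_of_le_of_ne h.2 fun h0 => ?_⟩⟩
    have h1 := h.1
    have := sum_nn x
    unfold mink at h1
    rw [← h0] at h1
    linarith
  rw [this]
  exact (isClosed_eq (continuous_id.mink continuous_id) continuous_const).inter
    (isClosed_le continuous_const (continuous_apply 0))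

lemma hyp_coord {z : Fin (n + 1) → ℝ} (i : Fin (n + 1)) : z i ^ 2 ≤ z 0 ^ 2 + |z 0 ^ 2 + mink z z| := by
  refine Fin.cases ?_ (fun i => ?_) i
  · have := abs_nonneg (z 0 ^ 2 + mink z z); linarith
  · have : z i.succ * z i.succ ≤ ∑ i : Fin n, z i.succ * z i.succ :=
      Finset.single_le_sum (f := fun i : Fin n => z i.succ * z i.succ)
        (fun i _ => mul_self_nonneg _) (Finset.mem_univ i)
    have h2 : z 0 ^ 2 + mink z z = ∑ i : Fin n, z i.succ * z i.succ := by unfold mink; ring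
    have := le_abs_self (z 0 ^ 2 + mink z z)
    nlinarith [sq_nonneg (z 0)]

lemma bdd_of_coord {S : Set (Fin (n + 1) → ℝ)} (M : ℝ) (h : ∀ z ∈ S, z 0 ^ 2 ≤ M)
    (h2 : ∀ z ∈ S, |mink z z| ≤ 1) : Bornology.IsBounded S := by
  refine (Metric.isBounded_closedBall (x := (0 : Fin (n + 1) → ℝ)) (r := 2 * M + 2)).subset ?_
  intro z hz
  have h0 := h z hz
  have hM : 0 ≤ M := (sq_nonneg _).trans h0
  rw [mem_closedBall_zero_iff, pi_norm_le_iff_of_nonneg (by linarith)]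
  intro i
  have h3 := hyp_coord (z := z) i
  have h4 := abs_add_le (z 0 ^ 2) (mink z z)
  rw [abs_of_nonneg (sq_nonneg (z 0))] at h4
  have h5 := h2 z hz
  rw [Real.norm_eq_abs]
  apply abs_le_of_sq_le_sq _ (by linarith)
  nlinarith

lemma compact_sub {x : Fin (n + 1) → ℝ} (hx : x ∈ Tm n) (M : ℝ) :
    IsCompact {z | z ∈ hypSpace n ∧ -mink x z ≤ M} := by
  let e : Fin (n + 1) → ℝ := Pi.single 0 1
  have he : ∀ z, mink e z = - z 0 := by
    intro z; simp [mink, e, Fin.succ_ne_zero]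
  have hc : Continuous (fun δ : ℝ => x - δ • e) := by fun_prop
  have h1 : ∀ᶠ δ in 𝓝 (0 : ℝ), x - δ • e ∈ Tm n :=
    hc.continuousAt.eventually_mem (isOpen_Tm.mem_nhds (by simpa using hx))
  obtain ⟨δ, hδ, hδ0⟩ := ((h1.filter_mono nhdsWithin_le_nhds).and
    (self_mem_nhdsWithin (s := Ioi (0 : ℝ)))).exists
  have hδ0 : 0 < δ := hδ0
  apply Metric.isCompact_of_isClosed_isBounded
  · exact isClosed_hyp.inter (isClosed_le (continuous_const.mink continuous_id).neg
      continuous_const)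
  · refine bdd_of_coord ((M / δ) ^ 2) ?_ ?_
    · rintro z ⟨hz, hzM⟩
      have := mink_neg_of_Tm hδ (hyp_sub_Tm hz)
      rw [mink_sub_left, mink_smul_left, he] at this
      have h2 : z 0 ≤ M / δ := by rw [le_div_iff₀ hδ0]; nlinarith
      exact pow_le_pow_left₀ hz.2.le h2 2
    · rintro z ⟨hz, -⟩
      rw [hz.1]; norm_num

lemma bdd_orth {x : Fin (n + 1) → ℝ} (hx : mink x x < 0) :
    Bornology.IsBounded {t : Fin (n + 1) → ℝ | mink x t = 0 ∧ mink t t = 1} := by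
  refine bdd_of_coord ((∑ i : Fin n, x i.succ * x i.succ) / (-mink x x)) ?_ ?_
  · rintro t ⟨h1, h2⟩
    have h := sum_cs x t
    rw [le_div_iff₀ (by linarith)]
    unfold mink at *
    set X := ∑ i : Fin n, x i.succ * x i.succ
    set Y := ∑ i : Fin n, t i.succ * t i.succ
    set S := ∑ i : Fin n, x i.succ * t i.succ
    have hS : S = x 0 * t 0 := by linarith
    have hY : Y = 1 + t 0 * t 0 := by linarith
    rw [hS, hY] at h
    nlinarith
  · rintro t ⟨h1, h2⟩
    rw [h2]; norm_num

end Basic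

section Edel
open Set Filter Topology

lemma edel {X : Type*} [TopologicalSpace X] [T2Space X] (K : Set X) (hK : K.Nonempty)
    (R : Set (X × X)) (hR : IsCompact R) (hRK : ∀ r ∈ R, r.1 ∈ K ∧ r.2 ∈ K)
    (hRt : ∀ x ∈ K, ∃ y, (x, y) ∈ R) (push : ℝ → X → X)
    (hcont : ContinuousOn (fun q : ℝ × X => push q.1 q.2) (Icc 0 1 ×ˢ K))
    (h0 : ∀ y ∈ K, push 0 y = y)
    (hpush : ∀ ε, 0 < ε → ∀ y ∈ K, push ε y ∈ K)
    (d : X → X → ℝ) (hd : Continuous (fun q : X × X => d q.1 q.2))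
    (hself : ∀ x ∈ K, ∀ y ∈ K, x ≠ y → d y y < d x y)
    (hstrict : ∀ ε, 0 < ε → ∀ x ∈ K, ∀ y ∈ K, x ≠ y → d (push ε x) (push ε y) < d x y)
    (hnon : ∀ r ∈ R, ∀ r' ∈ R, d r.2 r'.2 ≤ d r.1 r'.1) : ∃ x, (x, x) ∈ R := by
  obtain ⟨k, hk⟩ := hK
  obtain ⟨k', hk'⟩ := hRt k hk
  have step : ∀ ε, 0 < ε → ε ≤ 1 → ∃ r ∈ R, r.1 = push ε r.2 := by
    intro ε hε hε1
    have hc : ContinuousOn (fun r : X × X => d r.1 (push ε r.2)) R := by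
      have hc2 : ContinuousOn (fun r : X × X => push ε r.2) R :=
        hcont.comp (f := fun r : X × X => (ε, r.2)) (by fun_prop)
          (fun r hr => ⟨⟨hε.le, hε1⟩, (hRK r hr).2⟩)
      exact hd.comp_continuousOn (f := fun r : X × X => (r.1, push ε r.2))
        (continuousOn_fst.prodMk hc2)
    obtain ⟨r, hr, hmin⟩ := hR.exists_isMinOn ⟨_, hk'⟩ hc
    refine ⟨r, hr, ?_⟩
    by_contra hne
    have hx1 := hpush ε hε _ (hRK r hr).2
    obtain ⟨y1, hy1⟩ := hRt _ hx1
    have h1 : d r.1 (push ε r.2) ≤ d (push ε r.2) (push ε y1) := hmin hy1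
    have h2 : d r.2 y1 ≤ d r.1 (push ε r.2) := hnon r hr _ hy1
    by_cases hy : r.2 = y1
    · have := hself _ (hRK r hr).1 _ hx1 hne
      rw [← hy] at h1
      linarith
    · have := hstrict ε hε _ (hRK r hr).2 _ (hRK _ hy1).2 hy
      linarith
  have hKc : IsCompact ((Icc (0 : ℝ) 1) ×ˢ R) := isCompact_Icc.prod hR
  have hS : IsCompact {q : ℝ × X × X | q ∈ (Icc (0 : ℝ) 1) ×ˢ R ∧ q.2.1 = push q.1 q.2.2} := by
    have hc : ContinuousOn (fun q : ℝ × X × X => (q.2.1, push q.1 q.2.2)) ((Icc (0 : ℝ) 1) ×ˢ R) := by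
      refine ContinuousOn.prodMk (by fun_prop) ?_
      exact hcont.comp (f := fun q : ℝ × X × X => (q.1, q.2.2)) (by fun_prop)
        (fun r hr => ⟨hr.1, (hRK _ hr.2).2⟩)
    have := hc.preimage_isClosed_of_isClosed hKc.isClosed (isClosed_diagonal (X := X))
    exact hKc.of_isClosed_subset this inter_subset_left
  have hI := (hS.image continuous_fst).isClosed
  have h01 : Ioc (0 : ℝ) 1 ⊆ Prod.fst ''
      {q : ℝ × X × X | q ∈ (Icc (0 : ℝ) 1) ×ˢ R ∧ q.2.1 = push q.1 q.2.2} := by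
    intro ε hε
    obtain ⟨r, hr, h⟩ := step ε hε.1 hε.2
    exact ⟨(ε, r), ⟨⟨⟨hε.1.le, hε.2⟩, hr⟩, h⟩, rfl⟩
  have h00 := closure_minimal h01 hI
  rw [closure_Ioc (by norm_num)] at h00
  obtain ⟨⟨ε, r⟩, ⟨⟨-, hr⟩, h⟩, he⟩ := h00 (left_mem_Icc.2 zero_le_one)
  simp only at he h hr
  rw [he, h0 _ (hRK r hr).2] at h
  refine ⟨r.1, ?_⟩
  convert hr using 1
  exact Prod.ext rfl h

variable {n : ℕ}

lemma mink_nrm (u v : Fin (n + 1) → ℝ) :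
    mink (nrm u) (nrm v) = mink u v / (√|mink u u| * √|mink v v|) := by
  unfold nrm
  rw [mink_smul_left, mink_smul_right, div_eq_mul_inv, mul_inv]; ring

lemma strict_hyp {x y p : Fin (n + 1) → ℝ} (hx : x ∈ hypSpace n) (hy : y ∈ hypSpace n)
    (hp : p ∈ hypSpace n) (hxy : x ≠ y) {ε : ℝ} (hε : 0 < ε) :
    -mink (nrm (x + ε • p)) (nrm (y + ε • p)) < -mink x y := by
  have hg := gram hx hy hp
  have hc := hyp_mink_lt hx hy hxy
  have ha := hyp_mink_le hx hp
  have hb := hyp_mink_le hy hp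
  rw [mink_nrm]
  obtain ⟨a, rfl'⟩ : ∃ a, a = -mink x p := ⟨_, rfl⟩
  obtain ⟨b, rfl''⟩ : ∃ b, b = -mink y p := ⟨_, rfl⟩
  obtain ⟨c, rfl'''⟩ : ∃ c, c = -mink x y := ⟨_, rfl⟩
  have e1 : mink x p = -a := by linarith
  have e2 : mink y p = -b := by linarith
  have e3 : mink x y = -c := by linarith
  have hu : mink (x + ε • p) (x + ε • p) = -(1 + ε ^ 2 + 2 * ε * a) := by
    simp only [mink_add_right, mink_smul_right, mink_add_left, mink_smul_left, mink_comm p x,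
      hx.1, hp.1, e1]; ring
  have hv : mink (y + ε • p) (y + ε • p) = -(1 + ε ^ 2 + 2 * ε * b) := by
    simp only [mink_add_right, mink_smul_right, mink_add_left, mink_smul_left, mink_comm p y,
      hy.1, hp.1, e2]; ring
  have huv : mink (x + ε • p) (y + ε • p) = -(c + ε * (a + b) + ε ^ 2) := by
    simp only [mink_add_right, mink_smul_right, mink_add_left, mink_smul_left, mink_comm p y,
      hp.1, e1, e2, e3]; ring
  rw [e1, e2, e3] at hg
  rw [e1] at ha
  rw [e2] at hb
  rw [e3] at hc
  rw [hu, hv, huv, e3, abs_neg, abs_neg]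
  have ha' : 1 ≤ a := by linarith
  have hb' : 1 ≤ b := by linarith
  have hc' : 1 < c := by linarith
  clear hu hv huv e1 e2 e3 rfl' rfl'' rfl''' ha hb hc
  have hU : 0 < 1 + ε ^ 2 + 2 * ε * a := by positivity
  have hV : 0 < 1 + ε ^ 2 + 2 * ε * b := by positivity
  rw [abs_of_pos hU, abs_of_pos hV, ← Real.sqrt_mul hU.le, neg_div, neg_neg, neg_neg,
    div_lt_iff₀ (Real.sqrt_pos.2 (mul_pos hU hV))]
  have hN : 0 ≤ c + ε * (a + b) + ε ^ 2 := by positivity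
  have key : (c + ε * (a + b) + ε ^ 2) ^ 2 <
      c ^ 2 * ((1 + ε ^ 2 + 2 * ε * a) * (1 + ε ^ 2 + 2 * ε * b)) := by
    have hab : 1 ≤ a * b := by nlinarith
    have k1 : ε ^ 2 * (a + b) ^ 2 ≤ ε ^ 2 * (1 - c ^ 2 + 2 * (a * b) * (c + 1)) := by
      apply mul_le_mul_of_nonneg_left _ (by positivity); nlinarith
    have k2 : 0 < ε ^ 2 * (4 * c ^ 2 * (a * b) - 2 * (a * b) * (c + 1) + (c ^ 2 - 1)) := by
      apply mul_pos (by positivity)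
      have : 0 < c ^ 2 - 1 := by nlinarith
      have h2 : 0 ≤ 2 * (a * b) * (2 * c ^ 2 - (c + 1)) :=
        mul_nonneg (by positivity) (by nlinarith)
      nlinarith
    have k3 : 0 ≤ 2 * ε * (a + b) * (c ^ 2 * (1 + ε ^ 2) - c - ε ^ 2) := by
      apply mul_nonneg (by positivity)
      have h1 : 0 ≤ c * (c - 1) := mul_nonneg (by linarith) (by linarith)
      have h2 : 0 ≤ ε ^ 2 * (c ^ 2 - 1) := mul_nonneg (by positivity) (by nlinarith)
      nlinarith
    have k4 : (c + ε ^ 2) ^ 2 ≤ (c * (1 + ε ^ 2)) ^ 2 := by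
      apply pow_le_pow_left₀ (by positivity)
      have : 0 ≤ ε ^ 2 * (c - 1) := mul_nonneg (by positivity) (by linarith)
      nlinarith
    linear_combination k1 + k2 + k3 + k4
  calc c + ε * (a + b) + ε ^ 2 < √(c ^ 2 * ((1 + ε ^ 2 + 2 * ε * a) * (1 + ε ^ 2 + 2 * ε * b))) :=
        (Real.lt_sqrt hN).2 key
    _ = _ := by rw [Real.sqrt_mul (by positivity), Real.sqrt_sq (by linarith)]

lemma strict_euc {x y p : Fin (n + 1) → ℝ} (hx : mink x x = 1) (hy : mink y y = 1)
    (hp : 0 < mink p p) (hxp : 0 ≤ mink x p) (hyp : 0 ≤ mink y p) (hxy : mink x y < 1)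
    {ε : ℝ} (hε : 0 < ε) :
    -mink (nrm (x + ε • p)) (nrm (y + ε • p)) < -mink x y := by
  rw [mink_nrm]
  have hu : mink (x + ε • p) (x + ε • p) = 1 + 2 * ε * mink x p + ε ^ 2 * mink p p := by
    simp only [mink_add_right, mink_smul_right, mink_add_left, mink_smul_left, mink_comm p x,
      hx]; ring
  have hv : mink (y + ε • p) (y + ε • p) = 1 + 2 * ε * mink y p + ε ^ 2 * mink p p := by
    simp only [mink_add_right, mink_smul_right, mink_add_left, mink_smul_left, mink_comm p y,
      hy]; ring
  have huv : mink (x + ε • p) (y + ε • p) = ((mink (x + ε • p) (x + ε • p)) +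
      mink (y + ε • p) (y + ε • p)) / 2 - (1 - mink x y) := by
    rw [hu, hv]
    simp only [mink_add_right, mink_smul_right, mink_add_left, mink_smul_left, mink_comm p y]
    ring
  rw [huv]
  have hU : 1 < mink (x + ε • p) (x + ε • p) := by
    have : 0 < ε ^ 2 * mink p p := by positivity
    have : 0 ≤ 2 * ε * mink x p := by positivity
    linarith
  have hV : 1 < mink (y + ε • p) (y + ε • p) := by
    have : 0 < ε ^ 2 * mink p p := by positivity
    have : 0 ≤ 2 * ε * mink y p := by positivity
    linarith
  generalize mink (x + ε • p) (x + ε • p) = U at *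
  generalize mink (y + ε • p) (y + ε • p) = V at *
  generalize mink x y = c at *
  rw [abs_of_pos (by linarith), abs_of_pos (by linarith)]
  have h1 : 1 < √U := by rw [Real.lt_sqrt] <;> linarith
  have h2 : 1 < √V := by rw [Real.lt_sqrt] <;> linarith
  have h3 := Real.sq_sqrt (show 0 ≤ U by linarith)
  have h4 := Real.sq_sqrt (show 0 ≤ V by linarith)
  generalize √U = a at *
  generalize √V = b at *
  rw [neg_lt_neg_iff, lt_div_iff₀ (by nlinarith), ← h3, ← h4]
  have h5 : 1 < a * b := by nlinarith
  have h6 : 0 < (a * b - 1) * (1 - c) := mul_pos (by linarith) (by linarith)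
  nlinarith [sq_nonneg (a - b)]

end Edel

section Cham
open Set Filter Topology

/-- Properties of the (nonzero part of the) chamber used in the argument. -/
structure Cham {n : ℕ} (W : Subgroup ((Fin (n + 1) → ℝ) ≃ₗ[ℝ] (Fin (n + 1) → ℝ)))
    (C : Set (Fin (n + 1) → ℝ)) : Prop where
  form : ∀ w ∈ W, ∀ x y : Fin (n + 1) → ℝ, mink (w x) (w y) = mink x y
  sub : ∀ x ∈ C, x ∈ Tm n
  ne : C.Nonempty
  add : ∀ x ∈ C, ∀ y ∈ C, x + y ∈ C
  smul : ∀ x ∈ C, ∀ a : ℝ, 0 < a → a • x ∈ C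
  cov : ∀ v ∈ Tm n, ∃ w ∈ W, ∃ c ∈ C, w c = v
  fold : ∀ x ∈ C, ∀ y ∈ C, ∀ w ∈ W, mink x (w y) ≤ mink x y
  near : ∀ x ∈ C, ∀ᶠ y in 𝓝 x, ∃ g ∈ W, g x = x ∧ ∃ c ∈ C, g c = y
  cpt : IsCompact (C ∩ hypSpace n)
  fin : ∀ K : Set (Fin (n + 1) → ℝ), IsCompact K → K ⊆ hypSpace n →
      {g : (Fin (n + 1) → ℝ) ≃ₗ[ℝ] (Fin (n + 1) → ℝ) | g ∈ W ∧ ∃ x ∈ K, g x ∈ K}.Finite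

variable {n : ℕ} {W : Subgroup ((Fin (n + 1) → ℝ) ≃ₗ[ℝ] (Fin (n + 1) → ℝ))}
  {C : Set (Fin (n + 1) → ℝ)}

lemma Tm_eq {x y : Fin (n + 1) → ℝ} (hx : x ∈ Tm n) (hy : y ∈ Tm n)
    (h : mink x x = mink y y) (h2 : mink x x ≤ mink x y) : x = y := by
  by_contra hne
  have hs : mink (x + y) (x - y) = 0 := by
    simp only [mink_add_left, mink_sub_right, mink_comm y x]; linarith
  have := mink_pos_of_orth (Tm_add hx hy).1 hs (sub_ne_zero.2 hne)
  simp only [mink_sub_left, mink_sub_right, mink_comm y x] at this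
  linarith

lemma inv_app (g : (Fin (n + 1) → ℝ) ≃ₗ[ℝ] (Fin (n + 1) → ℝ)) (x : Fin (n + 1) → ℝ) :
    g⁻¹ (g x) = x := g.symm_apply_apply x

lemma app_inv (g : (Fin (n + 1) → ℝ) ≃ₗ[ℝ] (Fin (n + 1) → ℝ)) (x : Fin (n + 1) → ℝ) :
    g (g⁻¹ x) = x := g.apply_symm_apply x

lemma cont_equiv (g : (Fin (n + 1) → ℝ) ≃ₗ[ℝ] (Fin (n + 1) → ℝ)) : Continuous g :=
  LinearMap.continuous_of_finiteDimensional (g : (Fin (n + 1) → ℝ) →ₗ[ℝ] (Fin (n + 1) → ℝ))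

lemma compact_rel {K : Set (Fin (n + 1) → ℝ)} (hK : IsCompact K)
    (F : Set ((Fin (n + 1) → ℝ) ≃ₗ[ℝ] (Fin (n + 1) → ℝ))) (hF : F.Finite)
    (σ : (Fin (n + 1) → ℝ) →ₗ[ℝ] (Fin (n + 1) → ℝ)) :
    IsCompact {r : (Fin (n + 1) → ℝ) × (Fin (n + 1) → ℝ) |
      (r.1 ∈ K ∧ r.2 ∈ K) ∧ ∃ g ∈ F, g r.2 = σ r.1} := by
  have : {r : (Fin (n + 1) → ℝ) × (Fin (n + 1) → ℝ) |
      (r.1 ∈ K ∧ r.2 ∈ K) ∧ ∃ g ∈ F, g r.2 = σ r.1} = (K ×ˢ K) ∩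
      ⋃ g ∈ F, {r : (Fin (n + 1) → ℝ) × (Fin (n + 1) → ℝ) | g r.2 = σ r.1} := by
    ext r; simp [mem_prod]
  rw [this]
  refine (hK.prod hK).inter_right (hF.isClosed_biUnion fun g _ => ?_)
  exact isClosed_eq ((cont_equiv g).comp continuous_snd)
    ((LinearMap.continuous_of_finiteDimensional σ).comp continuous_fst)

lemma push_cont {K : Set (Fin (n + 1) → ℝ)} {p : Fin (n + 1) → ℝ}
    (h : ∀ ε : ℝ, 0 ≤ ε → ∀ y ∈ K, mink (y + ε • p) (y + ε • p) ≠ 0) :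
    ContinuousOn (fun q : ℝ × (Fin (n + 1) → ℝ) => nrm (q.2 + q.1 • p)) (Icc 0 1 ×ˢ K) :=
  nrm_cont.comp (f := fun q : ℝ × (Fin (n + 1) → ℝ) => q.2 + q.1 • p)
    (by fun_prop) (fun q hq => h q.1 hq.1.1 q.2 hq.2)

namespace Cham

lemma fold2 (h : Cham W C) {x y : Fin (n + 1) → ℝ} (hx : x ∈ C) (hy : y ∈ C)
    {w w' : (Fin (n + 1) → ℝ) ≃ₗ[ℝ] (Fin (n + 1) → ℝ)} (hw : w ∈ W) (hw' : w' ∈ W) :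
    mink (w x) (w' y) ≤ mink x y := by
  have := h.fold x hx y hy (w⁻¹ * w') (W.mul_mem (W.inv_mem hw) hw')
  rw [← h.form w hw x, LinearEquiv.mul_apply, app_inv] at this
  exact this

lemma start (h : Cham W C) (σ : (Fin (n + 1) → ℝ) →ₗ[ℝ] (Fin (n + 1) → ℝ))
    (hσ : ∀ x y, mink (σ x) (σ y) = mink x y) (hσT : ∀ x ∈ hypSpace n, σ x ∈ hypSpace n) :
    ∃ x ∈ C, ∃ w ∈ W, w x = σ x := by
  obtain ⟨p0, hp0⟩ := h.ne
  have hnrm : ∀ y ∈ C, nrm y ∈ C ∩ hypSpace n := fun y hy =>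
    ⟨h.smul y hy _ (nrm_pos (h.sub y hy).1.ne), nrm_mem (h.sub y hy)⟩
  obtain ⟨p, hp⟩ : ∃ p, p ∈ C ∩ hypSpace n := ⟨_, hnrm p0 hp0⟩
  set D := C ∩ hypSpace n with hD
  have hpushC : ∀ ε : ℝ, 0 ≤ ε → ∀ y ∈ D, y + ε • p ∈ C := by
    intro ε hε y hy
    rcases hε.eq_or_lt with rfl | h0
    · simpa using hy.1
    · exact h.add _ hy.1 _ (h.smul _ hp.1 _ h0)
  have hσc := LinearMap.continuous_of_finiteDimensional σ
  have hcK : IsCompact (D ∪ σ '' D) := h.cpt.union (h.cpt.image hσc)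
  have hF := h.fin _ hcK (by
    rintro z (hz | ⟨z, hz, rfl⟩)
    · exact hz.2
    · exact hσT _ hz.2)
  obtain ⟨x, hx⟩ := edel D ⟨p, hp⟩ _ (compact_rel h.cpt _ hF σ) (fun r hr => hr.1) (by
      intro x hx
      have hT := hσT x hx.2
      obtain ⟨w, hw, c, hc, hwc⟩ := h.cov _ (hyp_sub_Tm hT)
      have hcD : c ∈ D := by
        refine ⟨hc, ?_, (h.sub c hc).2⟩
        rw [← h.form w hw, hwc, hT.1]
      exact ⟨c, ⟨hx, hcD⟩, w, ⟨hw, c, Or.inl hcD, Or.inr ⟨x, hx, hwc.symm⟩⟩, hwc⟩)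
    (fun ε y => nrm (y + ε • p))
    (push_cont fun ε hε y hy => (h.sub _ (hpushC ε hε y hy)).1.ne)
    (by
      intro y hy
      simp only [zero_smul, add_zero]
      exact nrm_eq_self (by rw [hy.2.1]; norm_num))
    (fun ε hε y hy => hnrm _ (hpushC ε hε.le y hy))
    (fun x y => - mink x y) continuous_mink.neg
    (by
      intro x hx y hy hxy
      have := hyp_mink_lt hx.2 hy.2 hxy
      rw [hy.2.1]; linarith)
    (fun ε hε x hx y hy hxy => strict_hyp hx.2 hy.2 hp.2 hxy hε)
    (by
      rintro ⟨x, y⟩ ⟨⟨hx, hy⟩, w, ⟨hw, -⟩, hwy⟩ ⟨x', y'⟩ ⟨⟨hx', hy'⟩, w', ⟨hw', -⟩, hwy'⟩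
      simp only at *
      have := h.fold2 hy.1 hy'.1 hw hw'
      rw [hwy, hwy', hσ] at this
      linarith)
  obtain ⟨⟨hx, -⟩, w, ⟨hw, -⟩, hwx⟩ := hx
  exact ⟨x, hx.1, w, hw, hwx⟩

end Cham
end Cham

section Step
open Set Filter Topology

variable {n : ℕ} {W : Subgroup ((Fin (n + 1) → ℝ) ≃ₗ[ℝ] (Fin (n + 1) → ℝ))}
  {C : Set (Fin (n + 1) → ℝ)}

/-- tangent cone -/
def tcone (C : Set (Fin (n + 1) → ℝ)) (x : Fin (n + 1) → ℝ) : Set (Fin (n + 1) → ℝ) :=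
  {t | ∃ δ : ℝ, 0 < δ ∧ ∀ ε : ℝ, 0 < ε → ε < δ → x + ε • t ∈ C}

namespace Cham

lemma tcone_of (h : Cham W C) {x t : Fin (n + 1) → ℝ} (hx : x ∈ C) {δ : ℝ} (hδ : 0 < δ)
    (ht : x + δ • t ∈ C) : t ∈ tcone C x := by
  refine ⟨δ, hδ, fun ε hε hεδ => ?_⟩
  have h1 : x + ε • t = (1 - ε / δ) • x + (ε / δ) • (x + δ • t) := by
    rw [smul_add, smul_smul, div_mul_cancel₀ _ hδ.ne', ← add_assoc, ← add_smul]
    simp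
  rw [h1]
  exact h.add _ (h.smul _ hx _ (by rw [sub_pos, div_lt_one hδ]; exact hεδ)) _
    (h.smul _ ht _ (by positivity))

lemma tcone_add (h : Cham W C) {x t s : Fin (n + 1) → ℝ} (ht : t ∈ tcone C x)
    (hs : s ∈ tcone C x) : t + s ∈ tcone C x := by
  obtain ⟨δ, hδ, h1⟩ := ht
  obtain ⟨δ', hδ', h2⟩ := hs
  refine ⟨min δ δ' / 2, by positivity, fun ε hε hε2 => ?_⟩
  have h3 : x + ε • (t + s) = (1 / 2 : ℝ) • (x + (2 * ε) • t) + (1 / 2 : ℝ) • (x + (2 * ε) • s) := by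
    module
  have := min_le_left δ δ'
  have := min_le_right δ δ'
  rw [h3]
  exact h.add _ (h.smul _ (h1 _ (by linarith) (by linarith)) _ (by norm_num)) _
    (h.smul _ (h2 _ (by linarith) (by linarith)) _ (by norm_num))

lemma tcone_smul {x t : Fin (n + 1) → ℝ} (ht : t ∈ tcone C x) {a : ℝ}
    (ha : 0 < a) : a • t ∈ tcone C x := by
  obtain ⟨δ, hδ, h1⟩ := ht
  refine ⟨δ / a, by positivity, fun ε hε hε2 => ?_⟩
  rw [smul_smul]
  exact h1 _ (by positivity) (by rwa [lt_div_iff₀ ha] at hε2)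

lemma tcone_cov (h : Cham W C) {x : Fin (n + 1) → ℝ} (hx : x ∈ C) (t : Fin (n + 1) → ℝ) :
    ∃ g ∈ W, g x = x ∧ ∃ s ∈ tcone C x, g s = t := by
  have hc : Continuous (fun ε : ℝ => x + ε • t) := by fun_prop
  have h1 : Tendsto (fun ε : ℝ => x + ε • t) (𝓝[>] 0) (𝓝 x) := by
    have := hc.tendsto 0
    simp only [zero_smul, add_zero] at this
    exact this.mono_left nhdsWithin_le_nhds
  obtain ⟨ε, ⟨g, hg, hgx, c, hcC, hgc⟩, hε⟩ := ((h1.eventually (h.near x hx)).and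
    (self_mem_nhdsWithin (s := Ioi (0 : ℝ)))).exists
  have hε : 0 < ε := hε
  refine ⟨g, hg, hgx, g⁻¹ t, h.tcone_of hx hε ?_, app_inv g t⟩
  have : x + ε • g⁻¹ t = c := by
    apply g.injective
    rw [map_add, map_smul, app_inv, hgx, hgc]
  rw [this]; exact hcC

lemma tcone_fold (h : Cham W C) {x t s : Fin (n + 1) → ℝ} (ht : t ∈ tcone C x)
    (hs : s ∈ tcone C x) {g : (Fin (n + 1) → ℝ) ≃ₗ[ℝ] (Fin (n + 1) → ℝ)} (hg : g ∈ W)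
    (hgx : g x = x) : mink t (g s) ≤ mink t s := by
  obtain ⟨δ, hδ, h1⟩ := ht
  obtain ⟨δ', hδ', h2⟩ := hs
  obtain ⟨ε, hε, hε2⟩ := exists_between (show 0 < min δ δ' by positivity)
  have := h.fold _ (h1 ε hε (hε2.trans_le (min_le_left _ _))) _
    (h2 ε hε (hε2.trans_le (min_le_right _ _))) g hg
  have hxs : mink x (g s) = mink x s := by
    rw [← h.form g hg x s, hgx]
  simp only [map_add, map_smul, hgx, mink_add_left, mink_add_right, mink_smul_left,
    mink_smul_right, hxs] at this
  have h3 : ε ^ 2 * mink t (g s) ≤ ε ^ 2 * mink t s := by linarith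
  exact le_of_mul_le_mul_left h3 (by positivity)

lemma tcone_inv (h : Cham W C) {x a : Fin (n + 1) → ℝ} (hx : x ∈ C)
    (ha : ∀ g ∈ W, g x = x → g a = a) : a ∈ tcone C x := by
  obtain ⟨g, hg, hgx, s, hs, hgs⟩ := h.tcone_cov hx a
  have : s = a := g.injective (by rw [hgs, ha g hg hgx])
  rwa [← this]

lemma stab_fin (h : Cham W C) {x : Fin (n + 1) → ℝ} (hx : x ∈ C) :
    {g | g ∈ W ∧ g x = x}.Finite := by
  have hT := h.sub x hx
  refine (h.fin {nrm x} isCompact_singleton (by simpa using nrm_mem hT)).subset ?_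
  rintro g ⟨hg, hgx⟩
  refine ⟨hg, nrm x, rfl, ?_⟩
  simp [nrm, hgx]

/-- A direction in the tangent cone making nonnegative products with it. -/
lemma exists_p (h : Cham W C) {x : Fin (n + 1) → ℝ} (hx : x ∈ C)
    (hnt : ∃ g ∈ W, g x = x ∧ g ≠ 1) : ∃ p ∈ tcone C x, p ≠ 0 ∧
      (∀ c ∈ tcone C x, 0 ≤ mink c p) ∧
      (∀ l, (∀ g ∈ W, g x = x → g l = l) → mink l p = 0) := by
  obtain ⟨q, hq, g1, hg1, hg1x, hg1q⟩ : ∃ q ∈ tcone C x, ∃ g ∈ W, g x = x ∧ g q ≠ q := by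
    by_contra hcon
    push Not at hcon
    obtain ⟨g0, hg0, hg0x, hg01⟩ := hnt
    apply hg01
    ext1 t
    obtain ⟨g, hg, hgx, s, hs, hgs⟩ := h.tcone_cov hx t
    rw [hcon s hs g hg hgx] at hgs
    rw [← hgs]
    exact hcon s hs g0 hg0 hg0x
  classical
  set G := (h.stab_fin hx).toFinset with hG
  have hmem : ∀ g, g ∈ G ↔ g ∈ W ∧ g x = x := fun g => by simp [hG]
  have hone : (1 : (Fin (n + 1) → ℝ) ≃ₗ[ℝ] (Fin (n + 1) → ℝ)) ∈ G :=
    (hmem _).2 ⟨W.one_mem, rfl⟩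
  have hm : 0 < (G.card : ℝ) := by exact_mod_cast Finset.card_pos.2 ⟨_, hone⟩
  set S : Fin (n + 1) → ℝ := ∑ g ∈ G, g q with hS
  have hinv : ∀ g ∈ W, g x = x → g S = S := by
    intro g hg hgx
    rw [hS, map_sum]
    refine Finset.sum_equiv (Equiv.mulLeft g) (fun k => ?_) (fun k _ => rfl)
    rw [hmem, hmem, Equiv.coe_mulLeft, W.mul_mem_cancel_left hg, LinearEquiv.mul_apply]
    constructor
    · rintro ⟨h1, h2⟩; exact ⟨h1, by rw [h2, hgx]⟩
    · rintro ⟨h1, h2⟩; exact ⟨h1, g.injective (by rw [h2, hgx])⟩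
  have hminkp : ∀ c, mink c ((G.card : ℝ) • q - S) = ∑ g ∈ G, (mink c q - mink c (g q)) := by
    intro c
    rw [mink_sub_right, mink_smul_right, hS, mink_comm c (∑ g ∈ G, g q), mink_sum_left,
      Finset.sum_sub_distrib, Finset.sum_const, nsmul_eq_mul]
    simp only [mink_comm c]
  refine ⟨(G.card : ℝ) • q - S, ?_, ?_, ?_, ?_⟩
  · rw [sub_eq_add_neg]
    refine h.tcone_add (tcone_smul hq hm) (h.tcone_inv hx fun g hg hgx => ?_)
    rw [map_neg, hinv g hg hgx]
  · intro h0
    apply hg1q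
    have h1 : q = (G.card : ℝ)⁻¹ • S := by
      rw [← sub_eq_zero.1 h0, smul_smul, inv_mul_cancel₀ hm.ne', one_smul]
    rw [h1, map_smul, hinv g1 hg1 hg1x]
  · intro c hc
    rw [hminkp]
    refine Finset.sum_nonneg fun g hg => ?_
    have := h.tcone_fold hc hq ((hmem g).1 hg).1 ((hmem g).1 hg).2
    linarith
  · intro l hl
    rw [hminkp]
    refine Finset.sum_eq_zero fun g hg => ?_
    have h1 := h.form g ((hmem g).1 hg).1 l q
    rw [hl g ((hmem g).1 hg).1 ((hmem g).1 hg).2] at h1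
    linarith

lemma fix_of_both (h : Cham W C) {x l : Fin (n + 1) → ℝ} (hx : x ∈ C) (hl : l ∈ tcone C x)
    (hl' : -l ∈ tcone C x) {g : (Fin (n + 1) → ℝ) ≃ₗ[ℝ] (Fin (n + 1) → ℝ)} (hg : g ∈ W)
    (hgx : g x = x) : g l = l := by
  have h1 := h.tcone_fold hl hl hg hgx
  have h2 := h.tcone_fold hl' hl hg hgx
  rw [mink_neg_left, mink_neg_left] at h2
  by_contra hne
  have h3 : mink x (g l - l) = 0 := by
    rw [mink_sub_right]
    have := h.form g hg x l
    rw [hgx] at this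
    linarith
  have := mink_pos_of_orth (h.sub x hx).1 h3 (sub_ne_zero.2 hne)
  simp only [mink_sub_left, mink_sub_right, h.form g hg, mink_comm (g l) l] at this
  linarith

lemma step (h : Cham W C) (σ : (Fin (n + 1) → ℝ) →ₗ[ℝ] (Fin (n + 1) → ℝ))
    (hσ : ∀ x y, mink (σ x) (σ y) = mink x y)
    {w : (Fin (n + 1) → ℝ) ≃ₗ[ℝ] (Fin (n + 1) → ℝ)} (hw : w ∈ W)
    {x : Fin (n + 1) → ℝ} (hx : x ∈ C) (L : Submodule ℝ (Fin (n + 1) → ℝ)) (hxL : x ∈ L)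
    (hL : ∀ l ∈ L, σ l = w l) (hint : ∀ l ∈ L, l ∈ tcone C x)
    (hnt : ∃ g ∈ W, g x = x ∧ g ≠ 1) :
    ∃ w' ∈ W, ∃ x' ∈ C, ∃ L' : Submodule ℝ (Fin (n + 1) → ℝ), L < L' ∧ x' ∈ L' ∧
      (∀ l ∈ L', σ l = w' l) ∧ (∀ l ∈ L', l ∈ tcone C x') := by
  have hxx := (h.sub x hx).1
  obtain ⟨p, hp, hp0, hpc, hpl⟩ := h.exists_p hx hnt
  have hfix : ∀ l ∈ L, ∀ g ∈ W, g x = x → g l = l := fun l hl g hg hgx =>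
    h.fix_of_both hx (hint l hl) (hint _ (L.neg_mem hl)) hg hgx
  have hpL : ∀ l ∈ L, mink l p = 0 := fun l hl => hpl l (hfix l hl)
  have hpp : 0 < mink p p := mink_pos_of_orth hxx (hpL x hxL) hp0
  set K : Set (Fin (n + 1) → ℝ) := {t | t ∈ tcone C x ∧ (∀ l ∈ L, mink l t = 0) ∧ mink t t = 1}
    with hKdef
  have hlt : ∀ t s, mink x t = 0 → mink x s = 0 → mink t t = 1 → mink s s = 1 → t ≠ s →
      mink t s < 1 := by
    intro t s ht hs ht1 hs1 hne
    have h3 : mink x (t - s) = 0 := by rw [mink_sub_right]; linarith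
    have := mink_pos_of_orth hxx h3 (sub_ne_zero.2 hne)
    simp only [mink_sub_left, mink_sub_right, mink_comm s t] at this
    linarith
  have hKeq : K = {t | (∀ s ∈ tcone C x, ∀ g ∈ {g | g ∈ W ∧ g x = x}, mink t (g s) ≤ mink t s) ∧
      (∀ l ∈ (L : Set (Fin (n + 1) → ℝ)), mink l t = 0) ∧ mink t t = 1} := by
    ext t
    refine ⟨fun ht => ⟨fun s hs g hg => h.tcone_fold ht.1 hs hg.1 hg.2, ht.2⟩,
      fun ht => ⟨?_, ht.2⟩⟩
    obtain ⟨g, hg, hgx, s, hs, hgs⟩ := h.tcone_cov hx t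
    have h1 := ht.1 s hs g ⟨hg, hgx⟩
    rw [hgs, ht.2.2] at h1
    have h2 : mink s s = 1 := by rw [← h.form g hg, hgs, ht.2.2]
    have h3 : mink x s = 0 := by rw [← h.form g hg, hgs, hgx, ht.2.1 x hxL]
    have : t = s := by
      by_contra hne
      have := hlt t s (ht.2.1 x hxL) h3 ht.2.2 h2 hne
      linarith
    rwa [this]
  have hKcl : IsClosed K := by
    rw [hKeq]
    simp only [ofPred_and, ofPred_forall]
    refine IsClosed.inter ?_ (IsClosed.inter ?_ ?_)
    · refine isClosed_iInter fun s => isClosed_iInter fun _ => isClosed_iInter fun g =>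
        isClosed_iInter fun _ => isClosed_le ?_ ?_
      · exact continuous_id.mink continuous_const
      · exact continuous_id.mink continuous_const
    · exact isClosed_iInter fun l => isClosed_iInter fun _ =>
        isClosed_eq (continuous_const.mink continuous_id) continuous_const
    · exact isClosed_eq (continuous_id.mink continuous_id) continuous_const
  have hKc : IsCompact K := Metric.isCompact_of_isClosed_isBounded hKcl
    ((bdd_orth hxx).subset fun t ht => ⟨ht.2.1 x hxL, ht.2.2⟩)
  have hpos : ∀ ε : ℝ, 0 ≤ ε → ∀ y ∈ K, 0 < mink (y + ε • p) (y + ε • p) := by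
    intro ε hε y hy
    have h1 := hpc y hy.1
    simp only [mink_add_right, mink_smul_right, mink_add_left, mink_smul_left, mink_comm p y,
      hy.2.2]
    have : 0 ≤ ε * mink y p := by positivity
    have : 0 ≤ ε * (ε * mink p p) := by positivity
    linarith
  have hpushK : ∀ ε : ℝ, 0 < ε → ∀ y ∈ K, nrm (y + ε • p) ∈ K := by
    intro ε hε y hy
    have h1 := hpos ε hε.le y hy
    refine ⟨tcone_smul (h.tcone_add hy.1 (tcone_smul hp hε)) (nrm_pos h1.ne'), ?_,
      nrm_mink_one h1⟩
    intro l hl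
    unfold nrm
    have h2 : mink l (y + ε • p) = 0 := by
      rw [mink_add_right, mink_smul_right, hy.2.1 l hl, hpL l hl]; ring
    rw [mink_smul_right, h2, mul_zero]
  have hKne : K.Nonempty := by
    refine ⟨nrm p, tcone_smul hp (nrm_pos hpp.ne'), ?_, nrm_mink_one hpp⟩
    intro l hl
    unfold nrm
    rw [mink_smul_right, hpL l hl, mul_zero]
  have hF : ((fun g => w * g) '' {g | g ∈ W ∧ g x = x}).Finite := (h.stab_fin hx).image _
  obtain ⟨t, ht⟩ := edel K hKne _ (compact_rel hKc _ hF σ) (fun r hr => hr.1) (by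
      intro t ht
      obtain ⟨g, hg, hgx, s, hs, hgs⟩ := h.tcone_cov hx (w⁻¹ (σ t))
      have hgs' : w (g s) = σ t := by rw [hgs, app_inv]
      refine ⟨s, ⟨ht, hs, ?_, ?_⟩, w * g, ⟨g, ⟨hg, hgx⟩, rfl⟩, hgs'⟩
      · intro l hl
        change mink l s = 0
        rw [← h.form g hg, hfix l hl g hg hgx, ← h.form w hw, hgs', ← hL l hl, hσ, ht.2.1 l hl]
      · change mink s s = 1
        rw [← h.form g hg, ← h.form w hw, hgs', hσ, ht.2.2])
    (fun ε y => nrm (y + ε • p))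
    (push_cont fun ε hε y hy => (hpos ε hε y hy).ne')
    (by
      intro y hy
      simp only [zero_smul, add_zero]
      exact nrm_eq_self (by rw [hy.2.2]; norm_num))
    hpushK
    (fun x y => - mink x y) continuous_mink.neg
    (by
      intro t ht s hs hne
      have := hlt t s (ht.2.1 x hxL) (hs.2.1 x hxL) ht.2.2 hs.2.2 hne
      rw [hs.2.2]; linarith)
    (fun ε hε t ht s hs hne => strict_euc ht.2.2 hs.2.2 hpp (hpc t ht.1) (hpc s hs.1)
      (hlt t s (ht.2.1 x hxL) (hs.2.1 x hxL) ht.2.2 hs.2.2 hne) hε)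
    (by
      rintro ⟨t, s⟩ ⟨⟨ht, hs⟩, _, ⟨g, ⟨hg, hgx⟩, rfl⟩, hgs⟩ ⟨t', s'⟩
        ⟨⟨ht', hs'⟩, _, ⟨g', ⟨hg', hgx'⟩, rfl⟩, hgs'⟩
      simp only [LinearEquiv.mul_apply] at *
      have h1 := h.tcone_fold hs.1 hs'.1 (g := g⁻¹ * g') (W.mul_mem (W.inv_mem hg) hg') (by
        rw [LinearEquiv.mul_apply, hgx']
        exact g.injective (by rw [app_inv, hgx]))
      rw [← h.form g hg s, LinearEquiv.mul_apply, app_inv, ← h.form w hw, hgs, hgs', hσ] at h1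
      linarith)
  obtain ⟨⟨ht, -⟩, _, ⟨g, ⟨hg, hgx⟩, rfl⟩, hgt⟩ := ht
  simp only [LinearEquiv.mul_apply] at hgt ht
  have htL : t ∉ L := by
    intro hc
    have h1 := ht.2.1 t hc
    rw [ht.2.2] at h1
    exact one_ne_zero h1
  obtain ⟨δ, hδ, htδ⟩ := ht.1
  have hx' : x + (δ / 2) • t ∈ C := htδ _ (by linarith) (by linarith)
  refine ⟨w * g, W.mul_mem hw hg, x + (δ / 2) • t, hx', L ⊔ Submodule.span ℝ {t}, ?_, ?_, ?_, ?_⟩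
  · refine lt_of_le_of_ne le_sup_left fun he => htL ?_
    rw [he]
    exact (le_sup_right : Submodule.span ℝ {t} ≤ L ⊔ Submodule.span ℝ {t})
      (Submodule.mem_span_singleton_self t)
  · exact Submodule.add_mem_sup hxL (Submodule.smul_mem _ _ (Submodule.mem_span_singleton_self t))
  · intro l hl
    obtain ⟨l, hl', _, hs, rfl⟩ := Submodule.mem_sup.1 hl
    obtain ⟨τ, rfl⟩ := Submodule.mem_span_singleton.1 hs
    rw [map_add, map_smul, map_add, map_smul, LinearEquiv.mul_apply, LinearEquiv.mul_apply, hgt,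
      hfix l hl' g hg hgx, hL l hl']
  · intro l hl
    obtain ⟨l, hl', _, hs, rfl⟩ := Submodule.mem_sup.1 hl
    obtain ⟨τ, rfl⟩ := Submodule.mem_span_singleton.1 hs
    obtain ⟨δ1, hδ1, hlδ⟩ := hint l hl'
    have hτ : 0 < |τ| + 1 := by positivity
    set η := min (δ1 / 8) (δ / (8 * (|τ| + 1))) with hη
    have hη0 : 0 < η := by positivity
    have hη1 : η ≤ δ1 / 8 := min_le_left _ _
    have hη2 : η ≤ δ / (8 * (|τ| + 1)) := min_le_right _ _
    rw [le_div_iff₀ (by positivity)] at hη2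
    have hητ : |η * τ| ≤ δ / 8 := by
      rw [abs_mul, abs_of_pos hη0]; nlinarith
    rw [abs_le] at hητ
    refine h.tcone_of hx' hη0 ?_
    have h4 : x + (δ / 2) • t + η • (l + τ • t) = (1 / 4 : ℝ) • (x + (4 * η) • l) +
        (3 / 4 : ℝ) • (x + (2 / 3 * δ + 4 / 3 * (η * τ)) • t) := by module
    rw [h4]
    exact h.add _ (h.smul _ (hlδ _ (by linarith) (by linarith)) _ (by norm_num)) _
      (h.smul _ (htδ _ (by linarith) (by linarith)) _ (by norm_num))

lemma exists_free (h : Cham W C) (σ : (Fin (n + 1) → ℝ) →ₗ[ℝ] (Fin (n + 1) → ℝ))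
    (hσ : ∀ x y, mink (σ x) (σ y) = mink x y) (hσT : ∀ x ∈ hypSpace n, σ x ∈ hypSpace n) :
    ∃ x ∈ interior C, ∃ w ∈ W, w x = σ x := by
  have main : ∀ k : ℕ, ∀ w ∈ W, ∀ x ∈ C, ∀ L : Submodule ℝ (Fin (n + 1) → ℝ),
      n + 1 ≤ k + Module.finrank ℝ L → x ∈ L → (∀ l ∈ L, σ l = w l) →
      (∀ l ∈ L, l ∈ tcone C x) → ∃ x ∈ interior C, ∃ w ∈ W, w x = σ x := by
    intro k
    induction k with
    | zero =>
      intro w hw x hx L hk hxL hL hint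
      by_cases hnt : ∃ g ∈ W, g x = x ∧ g ≠ 1
      · obtain ⟨w', hw', x', hx', L', hLL, -⟩ := h.step σ hσ hw hx L hxL hL hint hnt
        have h1 := Submodule.finrank_lt_finrank_of_lt hLL
        have h2 := Submodule.finrank_le L'
        simp at h2
        omega
      · push Not at hnt
        refine ⟨x, ?_, w, hw, (hL x hxL).symm⟩
        rw [mem_interior_iff_mem_nhds]
        filter_upwards [h.near x hx] with y hy
        obtain ⟨g, hg, hgx, c, hc, rfl⟩ := hy
        rw [hnt g hg hgx]
        exact hc
    | succ k ih =>
      intro w hw x hx L hk hxL hL hint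
      by_cases hnt : ∃ g ∈ W, g x = x ∧ g ≠ 1
      · obtain ⟨w', hw', x', hx', L', hLL, h3, h4, h5⟩ := h.step σ hσ hw hx L hxL hL hint hnt
        have h1 := Submodule.finrank_lt_finrank_of_lt hLL
        exact ih w' hw' x' hx' L' (by omega) h3 h4 h5
      · push Not at hnt
        refine ⟨x, ?_, w, hw, (hL x hxL).symm⟩
        rw [mem_interior_iff_mem_nhds]
        filter_upwards [h.near x hx] with y hy
        obtain ⟨g, hg, hgx, c, hc, rfl⟩ := hy
        rw [hnt g hg hgx]
        exact hc
  obtain ⟨x, hx, w, hw, hwx⟩ := h.start σ hσ hσT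
  refine main (n + 1) w hw x hx (Submodule.span ℝ {x}) (by omega)
    (Submodule.mem_span_singleton_self x) ?_ ?_
  · intro l hl
    obtain ⟨a, rfl⟩ := Submodule.mem_span_singleton.1 hl
    rw [map_smul, map_smul, hwx]
  · intro l hl
    obtain ⟨a, rfl⟩ := Submodule.mem_span_singleton.1 hl
    have h0 : 0 < |a| + 1 := by positivity
    refine h.tcone_of hx (inv_pos.2 h0) ?_
    have : x + (|a| + 1)⁻¹ • a • x = (1 + (|a| + 1)⁻¹ * a) • x := by module
    rw [this]
    refine h.smul x hx _ ?_
    have h1 := neg_abs_le a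
    have : 1 + (|a| + 1)⁻¹ * a = (|a| + 1)⁻¹ * (|a| + 1 + a) := by
      rw [mul_add _ (|a| + 1), inv_mul_cancel₀ h0.ne']
    rw [this]
    exact mul_pos (inv_pos.2 h0) (by linarith)

end Cham
end Step

section
open Set Filter Topology
variable {n : ℕ} {W : Subgroup ((Fin (n + 1) → ℝ) ≃ₗ[ℝ] (Fin (n + 1) → ℝ))}
  {x₀ : Fin (n + 1) → ℝ}

/-- positive roots -/
def Rt (W : Subgroup ((Fin (n + 1) → ℝ) ≃ₗ[ℝ] (Fin (n + 1) → ℝ))) (x₀ : Fin (n + 1) → ℝ) :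
    Set (Fin (n + 1) → ℝ) :=
  {e | 0 < mink e e ∧ 0 < mink x₀ e ∧ ∃ g ∈ W, ∀ x, g x = x - ((2 * mink x e) / mink e e) • e}

/-- closed chamber without the origin -/
def Cp (W : Subgroup ((Fin (n + 1) → ℝ) ≃ₗ[ℝ] (Fin (n + 1) → ℝ))) (x₀ : Fin (n + 1) → ℝ) :
    Set (Fin (n + 1) → ℝ) :=
  {v | v ∈ Tm n ∧ ∀ e ∈ Rt W x₀, 0 ≤ mink v e}

/-- open chamber -/
def Om (W : Subgroup ((Fin (n + 1) → ℝ) ≃ₗ[ℝ] (Fin (n + 1) → ℝ))) (x₀ : Fin (n + 1) → ℝ) :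
    Set (Fin (n + 1) → ℝ) :=
  {v | v ∈ Tm n ∧ ∀ e ∈ Rt W x₀, 0 < mink v e}

lemma refl_fix {g : (Fin (n + 1) → ℝ) ≃ₗ[ℝ] (Fin (n + 1) → ℝ)} {e : Fin (n + 1) → ℝ}
    (he : 0 < mink e e) (hg : ∀ x, g x = x - ((2 * mink x e) / mink e e) • e)
    (x : Fin (n + 1) → ℝ) : g x = x ↔ mink x e = 0 := by
  rw [hg]
  constructor
  · intro h
    have h1 : ((2 * mink x e) / mink e e) • e = 0 := by
      have := congrArg (fun z => x - z) h
      simpa using this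
    rcases smul_eq_zero.1 h1 with h2 | h2
    · rcases div_eq_zero_iff.1 h2 with h3 | h3
      · linarith
      · exact absurd h3 he.ne'
    · rw [h2, mink_zero_left] at he; exact absurd he (lt_irrefl _)
  · intro h; simp [h]

lemma mem_mirrors (hx₀ : x₀ ∉ minkMirrors W) (x : Fin (n + 1) → ℝ) :
    x ∈ minkMirrors W ↔ ∃ e ∈ Rt W x₀, mink x e = 0 := by
  constructor
  · intro h
    simp only [minkMirrors, mem_iUnion, mem_ofPred_eq, exists_prop] at h
    obtain ⟨g, ⟨hgW, e, he, hg⟩, hgx⟩ := h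
    have hne : mink x₀ e ≠ 0 := by
      intro h0
      apply hx₀
      simp only [minkMirrors, mem_iUnion, mem_ofPred_eq, exists_prop]
      exact ⟨g, ⟨hgW, e, he, hg⟩, (refl_fix he hg _).2 h0⟩
    have hxe := (refl_fix he hg x).1 hgx
    rcases lt_or_gt_of_ne hne with h1 | h1
    · refine ⟨-e, ⟨?_, ?_, g, hgW, ?_⟩, ?_⟩
      · rwa [mink_neg_left, mink_neg_right, neg_neg]
      · rw [mink_neg_right]; linarith
      · intro y
        rw [hg, mink_neg_left, mink_neg_right, mink_neg_right, neg_neg, smul_neg, mul_neg, neg_div,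
          neg_smul, neg_neg]
      · rw [mink_neg_right, hxe, neg_zero]
    · exact ⟨e, ⟨he, h1, g, hgW, hg⟩, hxe⟩
  · rintro ⟨e, ⟨he, h1, g, hgW, hg⟩, hxe⟩
    simp only [minkMirrors, mem_iUnion, mem_ofPred_eq, exists_prop]
    exact ⟨g, ⟨hgW, e, he, hg⟩, (refl_fix he hg _).2 hxe⟩

lemma x0_Om (hx : x₀ ∈ hypSpace n) : x₀ ∈ Om W x₀ := ⟨hyp_sub_Tm hx, fun _ he => he.2.1⟩

lemma Om_Cp {x : Fin (n + 1) → ℝ} (hx : x ∈ Om W x₀) : x ∈ Cp W x₀ :=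
  ⟨hx.1, fun e he => (hx.2 e he).le⟩

lemma Om_smul {x : Fin (n + 1) → ℝ} (hx : x ∈ Om W x₀) {a : ℝ} (ha : 0 < a) : a • x ∈ Om W x₀ :=
  ⟨Tm_smul hx.1 ha, fun e he => by rw [mink_smul_left]; exact mul_pos ha (hx.2 e he)⟩

lemma Cp_smul {x : Fin (n + 1) → ℝ} (hx : x ∈ Cp W x₀) {a : ℝ} (ha : 0 < a) : a • x ∈ Cp W x₀ :=
  ⟨Tm_smul hx.1 ha, fun e he => by rw [mink_smul_left]; exact mul_nonneg ha.le (hx.2 e he)⟩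

lemma Cp_add {x y : Fin (n + 1) → ℝ} (hx : x ∈ Cp W x₀) (hy : y ∈ Cp W x₀) : x + y ∈ Cp W x₀ :=
  ⟨Tm_add hx.1 hy.1, fun e he => by
    rw [mink_add_left]; exact add_nonneg (hx.2 e he) (hy.2 e he)⟩

lemma Om_add {x y : Fin (n + 1) → ℝ} (hx : x ∈ Om W x₀) (hy : y ∈ Cp W x₀) : x + y ∈ Om W x₀ :=
  ⟨Tm_add hx.1 hy.1, fun e he => by
    rw [mink_add_left]; exact add_pos_of_pos_of_nonneg (hx.2 e he) (hy.2 e he)⟩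

lemma Om_nrm {x : Fin (n + 1) → ℝ} (hx : x ∈ Om W x₀) : nrm x ∈ Om W x₀ :=
  Om_smul hx (nrm_pos hx.1.1.ne)

lemma Cp_nrm {x : Fin (n + 1) → ℝ} (hx : x ∈ Cp W x₀) : nrm x ∈ Cp W x₀ :=
  Cp_smul hx (nrm_pos hx.1.1.ne)

lemma Om_comb {x y : Fin (n + 1) → ℝ} (hx : x ∈ Om W x₀) (hy : y ∈ Cp W x₀) {s : ℝ}
    (h0 : 0 ≤ s) (h1 : s < 1) : (1 - s) • x + s • y ∈ Om W x₀ := by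
  rcases h0.eq_or_lt with h | h
  · rw [← h]; simpa using hx
  · exact Om_add (Om_smul hx (by linarith)) (Cp_smul hy h)

lemma comp_eq (hx : x₀ ∈ hypSpace n) (hx₀ : x₀ ∉ minkMirrors W) :
    connectedComponentIn (hypSpace n \ minkMirrors W) x₀ = Om W x₀ ∩ hypSpace n := by
  apply Subset.antisymm
  · intro y hy
    have hmem := connectedComponentIn_subset _ _ hy
    refine ⟨⟨hyp_sub_Tm hmem.1, fun e he => ?_⟩, hmem.1⟩
    have hpc : IsPreconnected (connectedComponentIn (hypSpace n \ minkMirrors W) x₀) :=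
      isPreconnected_connectedComponentIn
    have hc : Continuous (fun v : Fin (n + 1) → ℝ => mink v e) := continuous_id.mink continuous_const
    by_contra hneg
    have hx0m : x₀ ∈ connectedComponentIn (hypSpace n \ minkMirrors W) x₀ :=
      mem_connectedComponentIn ⟨hx, hx₀⟩
    obtain ⟨z, hz, hz0⟩ := hpc.intermediate_value hy hx0m hc.continuousOn
      (⟨not_lt.1 hneg, he.2.1.le⟩ : (0 : ℝ) ∈ Icc _ _)
    exact (connectedComponentIn_subset _ _ hz).2 ((mem_mirrors hx₀ z).2 ⟨e, he, hz0⟩)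
  · rintro y ⟨hyO, hyh⟩
    let p : ℝ → Fin (n + 1) → ℝ := fun s => nrm ((1 - s) • x₀ + s • y)
    have hO : ∀ s ∈ Icc (0 : ℝ) 1, (1 - s) • x₀ + s • y ∈ Om W x₀ := by
      intro s hs
      rcases hs.2.eq_or_lt with h | h
      · rw [h]; simpa using hyO
      · exact Om_comb (x0_Om hx) (Om_Cp hyO) hs.1 h
    have hpre : IsPreconnected (p '' Icc 0 1) := by
      apply isPreconnected_Icc.image
      refine nrm_cont.comp (by fun_prop) ?_
      intro s hs
      exact (hO s hs).1.1.ne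
    have h0 : p 0 = x₀ := by
      simp only [p, sub_zero, one_smul, zero_smul, add_zero]
      exact nrm_eq_self (by rw [hx.1]; norm_num)
    have h1 : p 1 = y := by
      simp only [p, sub_self, one_smul, zero_smul, zero_add]
      exact nrm_eq_self (by rw [hyh.1]; norm_num)
    refine hpre.subset_connectedComponentIn ⟨0, by simp, h0⟩ ?_ ⟨1, by simp, h1⟩
    rintro _ ⟨s, hs, rfl⟩
    refine ⟨nrm_mem (hO s hs).1, fun hm => ?_⟩
    obtain ⟨e, he, h⟩ := (mem_mirrors hx₀ _).1 hm
    exact ((Om_nrm (hO s hs)).2 e he).ne' h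

lemma Cp_closure (hx : x₀ ∈ hypSpace n) {y : Fin (n + 1) → ℝ} (hy : y ∈ Cp W x₀) :
    y ∈ closure (Om W x₀) := by
  have hc : Continuous (fun s : ℝ => (1 - s) • x₀ + s • y) := by fun_prop
  have h1 : Tendsto (fun s : ℝ => (1 - s) • x₀ + s • y) (𝓝[<] 1) (𝓝 y) := by
    have := hc.tendsto 1
    simp only [sub_self, one_smul, zero_smul, zero_add] at this
    exact this.mono_left nhdsWithin_le_nhds
  refine mem_closure_of_tendsto h1 ?_
  filter_upwards [self_mem_nhdsWithin, mem_nhdsWithin_of_mem_nhds (lt_mem_nhds (zero_lt_one))]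
    with s hs hs0
  exact Om_comb (x0_Om hx) hy (le_of_lt hs0) hs

lemma D_eq (hx : x₀ ∈ hypSpace n) (hx₀ : x₀ ∉ minkMirrors W) :
    closure (connectedComponentIn (hypSpace n \ minkMirrors W) x₀) ∩ hypSpace n
      = Cp W x₀ ∩ hypSpace n := by
  rw [comp_eq hx hx₀]
  apply Subset.antisymm
  · rintro y ⟨hy, hyh⟩
    refine ⟨⟨hyp_sub_Tm hyh, fun e he => ?_⟩, hyh⟩
    have hc : Continuous (fun v : Fin (n + 1) → ℝ => mink v e) := continuous_id.mink continuous_const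
    exact closure_minimal (s := Om W x₀ ∩ hypSpace n) (t := {v | 0 ≤ mink v e})
      (fun v hv => (hv.1.2 e he).le) (isClosed_le continuous_const hc) hy
  · rintro y ⟨hy, hyh⟩
    refine ⟨?_, hyh⟩
    have h1 : nrm y = y := nrm_eq_self (by rw [hyh.1]; norm_num)
    rw [← h1]
    have hca : ContinuousAt (nrm : (Fin (n + 1) → ℝ) → _) y := by
      refine nrm_cont.continuousAt ?_
      filter_upwards [isOpen_Tm.mem_nhds hy.1] with v hv using hv.1.ne
    refine closure_mono ?_ (mem_closure_image hca (Cp_closure hx hy))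
    rintro _ ⟨v, hv, rfl⟩
    exact ⟨Om_nrm hv, nrm_mem hv.1⟩

lemma C_eq {C D : Set (Fin (n + 1) → ℝ)} (hD : D = Cp W x₀ ∩ hypSpace n)
    (hC : C = {v : Fin (n + 1) → ℝ | ∃ t : ℝ, 0 ≤ t ∧ ∃ d ∈ D, v = t • d}) {v : Fin (n + 1) → ℝ}
    (hv : v ∈ C) : v = 0 ∨ v ∈ Cp W x₀ := by
  rw [hC] at hv
  obtain ⟨t, ht, d, hd, rfl⟩ := hv
  rcases ht.eq_or_lt with h | h
  · left; simp [← h]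
  · right; rw [hD] at hd; exact Cp_smul hd.1 h

lemma Cp_sub_C {C D : Set (Fin (n + 1) → ℝ)} (hD : D = Cp W x₀ ∩ hypSpace n)
    (hC : C = {v : Fin (n + 1) → ℝ | ∃ t : ℝ, 0 ≤ t ∧ ∃ d ∈ D, v = t • d}) :
    Cp W x₀ ⊆ C := by
  intro v hv
  rw [hC]
  have h : 0 < √|mink v v| := Real.sqrt_pos.2 (abs_pos.2 hv.1.1.ne)
  refine ⟨√|mink v v|, h.le, nrm v, by rw [hD]; exact ⟨Cp_nrm hv, nrm_mem hv.1⟩, ?_⟩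
  rw [nrm, smul_smul, mul_inv_cancel₀ h.ne', one_smul]

/-- finiteness hypothesis -/
def PD (W : Subgroup ((Fin (n + 1) → ℝ) ≃ₗ[ℝ] (Fin (n + 1) → ℝ))) : Prop :=
  ∀ K : Set (Fin (n + 1) → ℝ), IsCompact K → K ⊆ hypSpace n →
      {g : (Fin (n + 1) → ℝ) ≃ₗ[ℝ] (Fin (n + 1) → ℝ) | g ∈ W ∧ ∃ x ∈ K, g x ∈ K}.Finite

lemma nrm_ball {y : Fin (n + 1) → ℝ} (hy : y ∈ Tm n) : ∃ r > 0, Metric.closedBall y r ⊆ Tm n ∧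
    IsCompact (nrm '' Metric.closedBall y r) ∧ nrm '' Metric.closedBall y r ⊆ hypSpace n := by
  obtain ⟨r, hr, hb⟩ := Metric.nhds_basis_closedBall.mem_iff.1 (isOpen_Tm.mem_nhds hy)
  refine ⟨r, hr, hb, (isCompact_closedBall y r).image_of_continuousOn
    (nrm_cont.mono fun v hv => (hb hv).1.ne), ?_⟩
  rintro _ ⟨v, hv, rfl⟩
  exact nrm_mem (hb hv)

lemma isOpen_Om (hpd : PD W) : IsOpen (Om W x₀) := by
  rw [isOpen_iff_mem_nhds]
  intro y hy
  obtain ⟨r, hr, hb, hK, hKh⟩ := nrm_ball hy.1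
  have hF := hpd _ hK hKh
  have hev : ∀ g ∈ {g : (Fin (n + 1) → ℝ) ≃ₗ[ℝ] (Fin (n + 1) → ℝ) | g ∈ W ∧
      ∃ x ∈ nrm '' Metric.closedBall y r, g x ∈ nrm '' Metric.closedBall y r},
      ∀ᶠ v in 𝓝 y, ∀ e ∈ Rt W x₀, (∀ x, g x = x - ((2 * mink x e) / mink e e) • e) →
        0 < mink v e := by
    intro g _
    by_cases hex : ∃ e ∈ Rt W x₀, (∀ x, g x = x - ((2 * mink x e) / mink e e) • e)
    · obtain ⟨f, hf, hgf⟩ := hex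
      have hc : Continuous (fun v : Fin (n + 1) → ℝ => mink v f) :=
        continuous_id.mink continuous_const
      filter_upwards [hc.continuousAt.eventually (lt_mem_nhds (hy.2 f hf))] with v hv e he hge
      -- e is a positive multiple of f
      have h1 := hge x₀
      rw [hgf] at h1
      have h2 : (2 * mink x₀ f / mink f f) • f = (2 * mink x₀ e / mink e e) • e := by
        simpa using h1
      have h3 := congrArg (fun z => mink v z) h2
      simp only [mink_smul_right] at h3
      have a := hf.1
      have a' := hf.2.1
      have b := he.1
      have b' := he.2.1
      have : 0 < 2 * mink x₀ f / mink f f * mink v f := by positivity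
      rw [h3] at this
      exact (pos_iff_pos_of_mul_pos this).1 (by positivity)
    · exact Eventually.of_forall fun v e he hge => absurd ⟨e, he, hge⟩ hex
  have hall := (eventually_all_finite hF).2 hev
  filter_upwards [hall, Metric.closedBall_mem_nhds y hr] with v hv hvb
  refine ⟨hb hvb, fun e he => ?_⟩
  by_contra hneg
  have hc : Continuous (fun v : Fin (n + 1) → ℝ => mink v e) := continuous_id.mink continuous_const
  obtain ⟨m, hm, hm0⟩ := ((convex_closedBall y r).isPreconnected).intermediate_value hvb
    (Metric.mem_closedBall_self hr.le) hc.continuousOn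
    (⟨not_lt.1 hneg, (hy.2 e he).le⟩ : (0 : ℝ) ∈ Icc _ _)
  obtain ⟨he1, he2, g, hgW, hg⟩ := id he
  have hfix : g (nrm m) = nrm m := (refl_fix he1 hg _).2 (by
    rw [nrm, mink_smul_left]
    have : mink m e = 0 := hm0
    rw [this, mul_zero])
  exact hneg (hv g ⟨hgW, nrm m, ⟨m, hm, rfl⟩, by rw [hfix]; exact ⟨m, hm, rfl⟩⟩ e he hg)

lemma interior_sub {C : Set (Fin (n + 1) → ℝ)} (hC : ∀ v ∈ C, v = 0 ∨ v ∈ Cp W x₀) :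
    interior C ⊆ Om W x₀ := by
  intro x hx
  have hnb := mem_interior_iff_mem_nhds.1 hx
  have key : ∀ d : Fin (n + 1) → ℝ, ∃ s > (0 : ℝ), x + s • d ∈ C := by
    intro d
    have hc : Continuous (fun s : ℝ => x + s • d) := by fun_prop
    have h1 : Tendsto (fun s : ℝ => x + s • d) (𝓝[>] 0) (𝓝 x) := by
      have := hc.tendsto 0
      simp only [zero_smul, add_zero] at this
      exact this.mono_left nhdsWithin_le_nhds
    obtain ⟨s, hs, hs0⟩ := ((h1.eventually hnb).and self_mem_nhdsWithin).exists
    exact ⟨s, hs0, hs⟩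
  have hx0 : x ≠ 0 := by
    rintro rfl
    obtain ⟨s, hs, h⟩ := key (-Pi.single 0 1)
    rcases hC _ h with h | h
    · have := congrFun h 0
      simp at this; exact hs.ne' this
    · have := h.1.2
      simp at this; linarith
  have hxC : x ∈ Cp W x₀ := (hC x (interior_subset hx)).resolve_left hx0
  refine ⟨hxC.1, fun e he => lt_of_le_of_ne (hxC.2 e he) fun h0 => ?_⟩
  obtain ⟨s, hs, h⟩ := key (-e)
  have hm : mink (x + s • (-e)) e < 0 := by
    rw [mink_add_left, mink_smul_left, mink_neg_left, ← h0]
    nlinarith [he.1, mul_pos hs he.1]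
  rcases hC _ h with h | h
  · rw [h, mink_zero_left] at hm; exact lt_irrefl _ hm
  · exact absurd (h.2 e he) (not_le.2 hm)

end

section
open Set Filter Topology
variable {n : ℕ} {W : Subgroup ((Fin (n + 1) → ℝ) ≃ₗ[ℝ] (Fin (n + 1) → ℝ))}
  {x₀ : Fin (n + 1) → ℝ}

lemma W_Tm (hHinv : ∀ w ∈ W, ∀ x ∈ hypSpace n, w x ∈ hypSpace n)
    {w : (Fin (n + 1) → ℝ) ≃ₗ[ℝ] (Fin (n + 1) → ℝ)} (hw : w ∈ W) {x : Fin (n + 1) → ℝ}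
    (hx : x ∈ Tm n) : w x ∈ Tm n := by
  have h : 0 < √|mink x x| := Real.sqrt_pos.2 (abs_pos.2 hx.1.ne)
  have h1 : x = √|mink x x| • nrm x := by
    rw [nrm, smul_smul, mul_inv_cancel₀ h.ne', one_smul]
  rw [h1, map_smul]
  exact Tm_smul (hyp_sub_Tm (hHinv w hw _ (nrm_mem hx))) h

/-- `W` preserves the mirrors. -/
lemma mirror_inv (hform : ∀ w ∈ W, ∀ x y : Fin (n + 1) → ℝ, mink (w x) (w y) = mink x y)
    (hx₀ : x₀ ∉ minkMirrors W)
    {w : (Fin (n + 1) → ℝ) ≃ₗ[ℝ] (Fin (n + 1) → ℝ)} (hw : w ∈ W) {y : Fin (n + 1) → ℝ}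
    (hy : y ∈ Om W x₀) {e : Fin (n + 1) → ℝ} (he : e ∈ Rt W x₀) : mink (w y) e ≠ 0 := by
  intro h0
  obtain ⟨he1, he2, g, hgW, hg⟩ := he
  have hym : y ∈ minkMirrors W := by
    simp only [minkMirrors, mem_iUnion, mem_ofPred_eq, exists_prop]
    refine ⟨w⁻¹ * g * w, ⟨W.mul_mem (W.mul_mem (W.inv_mem hw) hgW) hw, w⁻¹ e, ?_, ?_⟩, ?_⟩
    · rwa [hform _ (W.inv_mem hw)]
    · intro x
      have h1 : mink x (w⁻¹ e) = mink (w x) e := by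
        rw [← hform w hw x (w⁻¹ e), app_inv]
      rw [hform _ (W.inv_mem hw), h1]
      change w⁻¹ (g (w x)) = _
      rw [hg, map_sub, map_smul, inv_app]
    · change w⁻¹ (g (w y)) = _
      rw [(refl_fix he1 hg _).2 h0, inv_app]
  obtain ⟨f, hf, hf0⟩ := (mem_mirrors hx₀ y).1 hym
  exact (hy.2 f hf).ne' hf0

/-- Strict folding on normalized vectors. -/
lemma strict_fold0 (hform : ∀ w ∈ W, ∀ x y : Fin (n + 1) → ℝ, mink (w x) (w y) = mink x y)
    (hHinv : ∀ w ∈ W, ∀ x ∈ hypSpace n, w x ∈ hypSpace n) (hpd : PD W)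
    (hx₀ : x₀ ∉ minkMirrors W)
    (hdisj : ∀ w ∈ W, w ≠ 1 → ∀ x ∈ Om W x₀, ∀ x' ∈ Om W x₀, w x ≠ x')
    {x y : Fin (n + 1) → ℝ} (hx : x ∈ Om W x₀) (hy : y ∈ Om W x₀) (hyh : y ∈ hypSpace n)
    {w : (Fin (n + 1) → ℝ) ≃ₗ[ℝ] (Fin (n + 1) → ℝ)} (hw : w ∈ W) (hw1 : w ≠ 1) :
    mink x (w y) < mink x y := by
  by_contra hle
  rw [not_lt] at hle
  have hK := compact_sub hx.1 (-mink x y)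
  have hF := hpd _ hK (fun z hz => hz.1)
  set F := {g : (Fin (n + 1) → ℝ) ≃ₗ[ℝ] (Fin (n + 1) → ℝ) | g ∈ W ∧
    ∃ z ∈ {z | z ∈ hypSpace n ∧ -mink x z ≤ -mink x y},
      g z ∈ {z | z ∈ hypSpace n ∧ -mink x z ≤ -mink x y}} with hFdef
  have memF : ∀ g ∈ W, mink x y ≤ mink x (g y) → g ∈ F := fun g hg h =>
    ⟨hg, y, ⟨hyh, le_rfl⟩, ⟨hHinv g hg y hyh, neg_le_neg h⟩⟩
  -- maximality implies identity
  have main : ∀ g ∈ W, (∀ g' ∈ W, mink x (g' y) ≤ mink x (g y)) → g = 1 := by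
    intro g hg hmax
    by_contra hg1
    refine hdisj g hg hg1 y hy (g y) ⟨W_Tm hHinv hg hy.1, fun e he => ?_⟩ rfl
    refine lt_of_le_of_ne ?_ (mirror_inv hform hx₀ hg hy he).symm
    obtain ⟨he1, he2, s, hsW, hs⟩ := id he
    have h1 := hmax (s * g) (W.mul_mem hsW hg)
    change mink x (s (g y)) ≤ _ at h1
    rw [hs, mink_sub_right, mink_smul_right] at h1
    have h2 : 0 ≤ 2 * mink (g y) e / mink e e * mink x e := by linarith
    have h3 := nonneg_of_mul_nonneg_left h2 (hx.2 e he)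
    have h4 := (le_div_iff₀ he1).1 h3
    linarith
  obtain ⟨g, hgF, hgmax⟩ := hF.exists_maximalFor (fun g => mink x (g y)) F
    ⟨1, memF 1 W.one_mem le_rfl⟩
  have h1F : (1 : (Fin (n + 1) → ℝ) ≃ₗ[ℝ] (Fin (n + 1) → ℝ)) ∈ F := memF 1 W.one_mem le_rfl
  have hmaxF : ∀ g' ∈ F, mink x (g' y) ≤ mink x (g y) := by
    intro g' hg'
    rcases le_total (mink x (g' y)) (mink x (g y)) with h | h
    · exact h
    · exact hgmax hg' h
  have hgy : mink x y ≤ mink x (g y) := hmaxF 1 h1F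
  have hall : ∀ g' ∈ W, mink x (g' y) ≤ mink x (g y) := by
    intro g' hg'
    rcases le_total (mink x y) (mink x (g' y)) with h | h
    · exact hmaxF g' (memF g' hg' h)
    · exact h.trans hgy
  have hg1 := main g hgF.1 hall
  rw [hg1] at hall
  exact hw1 (main w hw fun g' hg' => (hall g' hg').trans hle)

lemma strict_fold (hform : ∀ w ∈ W, ∀ x y : Fin (n + 1) → ℝ, mink (w x) (w y) = mink x y)
    (hHinv : ∀ w ∈ W, ∀ x ∈ hypSpace n, w x ∈ hypSpace n) (hpd : PD W)
    (hx₀ : x₀ ∉ minkMirrors W)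
    (hdisj : ∀ w ∈ W, w ≠ 1 → ∀ x ∈ Om W x₀, ∀ x' ∈ Om W x₀, w x ≠ x')
    {x y : Fin (n + 1) → ℝ} (hx : x ∈ Om W x₀) (hy : y ∈ Om W x₀)
    {w : (Fin (n + 1) → ℝ) ≃ₗ[ℝ] (Fin (n + 1) → ℝ)} (hw : w ∈ W) (hw1 : w ≠ 1) :
    mink x (w y) < mink x y := by
  have h := strict_fold0 hform hHinv hpd hx₀ hdisj hx (Om_nrm hy) (nrm_mem hy.1) hw hw1
  rw [nrm, map_smul, mink_smul_right, mink_smul_right] at h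
  exact lt_of_mul_lt_mul_left h (nrm_pos hy.1.1.ne).le

lemma weak_fold (hform : ∀ w ∈ W, ∀ x y : Fin (n + 1) → ℝ, mink (w x) (w y) = mink x y)
    (hHinv : ∀ w ∈ W, ∀ x ∈ hypSpace n, w x ∈ hypSpace n) (hpd : PD W)
    (hx : x₀ ∈ hypSpace n) (hx₀ : x₀ ∉ minkMirrors W)
    (hdisj : ∀ w ∈ W, w ≠ 1 → ∀ x ∈ Om W x₀, ∀ x' ∈ Om W x₀, w x ≠ x') :
    ∀ x ∈ Cp W x₀, ∀ y ∈ Cp W x₀, ∀ w ∈ W, mink x (w y) ≤ mink x y := by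
  intro x hxC y hyC w hw
  by_cases hw1 : w = 1
  · rw [hw1]; exact le_rfl
  have h1 : ∀ x ∈ Om W x₀, mink x (w y) ≤ mink x y := by
    intro x hxO
    refine closure_minimal (s := Om W x₀) (t := {v | mink x (w v) ≤ mink x v})
      (fun v hv => (strict_fold hform hHinv hpd hx₀ hdisj hxO hv hw hw1).le) ?_ (Cp_closure hx hyC)
    exact isClosed_le (continuous_const.mink (cont_equiv w)) (continuous_const.mink continuous_id)
  refine closure_minimal (s := Om W x₀) (t := {v | mink v (w y) ≤ mink v y})
      (fun v hv => h1 v hv) ?_ (Cp_closure hx hxC)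
  exact isClosed_le (continuous_id.mink continuous_const) (continuous_id.mink continuous_const)

lemma mkCham (hform : ∀ w ∈ W, ∀ x y : Fin (n + 1) → ℝ, mink (w x) (w y) = mink x y)
    (hHinv : ∀ w ∈ W, ∀ x ∈ hypSpace n, w x ∈ hypSpace n) (hpd : PD W)
    (hx : x₀ ∈ hypSpace n) (hx₀ : x₀ ∉ minkMirrors W)
    (hdisj : ∀ w ∈ W, w ≠ 1 → ∀ x ∈ Om W x₀, ∀ x' ∈ Om W x₀, w x ≠ x')
    (hcpt : IsCompact (Cp W x₀ ∩ hypSpace n))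
    (hcover : ∀ x ∈ hypSpace n, ∃ w ∈ W, ∃ d ∈ Cp W x₀ ∩ hypSpace n, w d = x) :
    Cham W (Cp W x₀) := by
  have hfold := weak_fold hform hHinv hpd hx hx₀ hdisj
  have hcov : ∀ v ∈ Tm n, ∃ w ∈ W, ∃ d ∈ Cp W x₀ ∩ hypSpace n, w d = nrm v ∧
      ∃ c ∈ Cp W x₀, w c = v := by
    intro v hv
    obtain ⟨w, hw, d, hd, hwd⟩ := hcover (nrm v) (nrm_mem hv)
    have h : 0 < √|mink v v| := Real.sqrt_pos.2 (abs_pos.2 hv.1.ne)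
    refine ⟨w, hw, d, hd, hwd, √|mink v v| • d, Cp_smul hd.1 h, ?_⟩
    rw [map_smul, hwd, nrm, smul_smul, mul_inv_cancel₀ h.ne', one_smul]
  refine ⟨hform, fun x hx => hx.1, ⟨x₀, Om_Cp (x0_Om hx)⟩, fun x hx y hy => Cp_add hx hy,
    fun x hx a ha => Cp_smul hx ha, ?_, hfold, ?_, hcpt, hpd⟩
  · intro v hv
    obtain ⟨w, hw, d, hd, hwd, h⟩ := hcov v hv
    exact ⟨w, hw, h⟩
  · intro x hxC
    obtain ⟨r, hr, hb, hK, hKh⟩ := nrm_ball hxC.1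
    have hF := hpd _ (hK.union hcpt) (union_subset hKh inter_subset_right)
    set K := nrm '' Metric.closedBall x r ∪ Cp W x₀ ∩ hypSpace n
    have hev : ∀ w ∈ {g : (Fin (n + 1) → ℝ) ≃ₗ[ℝ] (Fin (n + 1) → ℝ) | g ∈ W ∧
        ∃ x ∈ K, g x ∈ K}, ∀ᶠ y in 𝓝 x, w⁻¹ y ∈ Cp W x₀ → w⁻¹ x ∈ Cp W x₀ := by
      intro w hw
      by_cases hm : w⁻¹ x ∈ Cp W x₀
      · exact Eventually.of_forall fun _ _ => hm
      · have : ∃ e ∈ Rt W x₀, mink (w⁻¹ x) e < 0 := by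
          by_contra hcon
          push Not at hcon
          exact hm ⟨W_Tm hHinv (W.inv_mem hw.1) hxC.1, hcon⟩
        obtain ⟨e, he, hlt⟩ := this
        have hc : Continuous (fun v : Fin (n + 1) → ℝ => mink (w⁻¹ v) e) :=
          (cont_equiv w⁻¹).mink continuous_const
        filter_upwards [hc.continuousAt.eventually (gt_mem_nhds hlt)] with v hv hvC
        exact absurd (hvC.2 e he) (not_le.2 hv)
    have hall := (eventually_all_finite hF).2 hev
    filter_upwards [hall, Metric.closedBall_mem_nhds x hr] with y hy hyb
    obtain ⟨w, hw, d, hd, hwd, c, hc, hwc⟩ := hcov y (hb hyb)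
    have hwF := hy w ⟨hw, d, Or.inr hd, by rw [hwd]; exact Or.inl ⟨y, hyb, rfl⟩⟩
      (by rw [← hwc, inv_app]; exact hc)
    have hwi := W.inv_mem hw
    have h1 := hfold _ hwF _ hxC _ hwi
    have h2 : mink (w⁻¹ x) (w⁻¹ x) = mink x x := hform _ hwi _ _
    have h3 : w⁻¹ x = x := Tm_eq hwF.1 hxC.1 h2 h1
    refine ⟨w, hw, ?_, c, hc, hwc⟩
    conv_lhs => rw [← h3]
    rw [app_inv]

/-- minus the reflection fixing the time-like direction `u` -/
def sg (u : Fin (n + 1) → ℝ) : (Fin (n + 1) → ℝ) →ₗ[ℝ] (Fin (n + 1) → ℝ) where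
  toFun v := -v - (2 * mink v u) • u
  map_add' x y := by rw [mink_add_left]; module
  map_smul' a x := by rw [mink_smul_left]; simp only [RingHom.id_apply]; module

lemma sg_form {u : Fin (n + 1) → ℝ} (hu : mink u u = -1) (x y : Fin (n + 1) → ℝ) :
    mink (sg u x) (sg u y) = mink x y := by
  change mink (-x - (2 * mink x u) • u) (-y - (2 * mink y u) • u) = _
  simp only [mink_sub_left, mink_sub_right, mink_neg_left, mink_neg_right, mink_smul_left,
    mink_smul_right, hu, mink_comm u y]
  ring

lemma sg_hyp {u : Fin (n + 1) → ℝ} (hu : u ∈ hypSpace n) :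
    ∀ x ∈ hypSpace n, sg u x ∈ hypSpace n := by
  intro x hx
  have h1 := sg_form hu.1 x x
  refine ⟨h1.trans hx.1, (Tm_of_mink (x := u) ?_ (hyp_sub_Tm hu) ?_).2⟩
  · rw [h1, hx.1]; norm_num
  · change mink (-x - (2 * mink x u) • u) u < 0
    rw [mink_sub_left, mink_neg_left, mink_smul_left, hu.1]
    have := mink_neg_of_Tm (hyp_sub_Tm hx) (hyp_sub_Tm hu)
    linarith

end
/-- Hyperbolic analogue of Waldspurger's theorem, part (ii): the open negative cone
`K₋° = {x | [x, x] < 0, x₀ < 0}` is the disjoint union over `w ∈ W` of the sets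
`(-1 - w)(C°)`. -/
theorem hyperbolic_tiling_negative_cone
    {n : ℕ} (W : Subgroup ((Fin (n + 1) → ℝ) ≃ₗ[ℝ] (Fin (n + 1) → ℝ)))
    (D C : Set (Fin (n + 1) → ℝ))
    (hform : ∀ w ∈ W, ∀ x y : Fin (n + 1) → ℝ, mink (w x) (w y) = mink x y)
    (hHinv : ∀ w ∈ W, ∀ x ∈ hypSpace n, w x ∈ hypSpace n)
    (hWgen : Subgroup.closure
      {g : (Fin (n + 1) → ℝ) ≃ₗ[ℝ] (Fin (n + 1) → ℝ) | g ∈ W ∧ IsMinkRefl g} = W)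
    (hpd : ∀ K : Set (Fin (n + 1) → ℝ), IsCompact K → K ⊆ hypSpace n →
      {g : (Fin (n + 1) → ℝ) ≃ₗ[ℝ] (Fin (n + 1) → ℝ) | g ∈ W ∧ ∃ x ∈ K, g x ∈ K}.Finite)
    (hD : ∃ x₀ ∈ hypSpace n \ minkMirrors W,
      D = closure (connectedComponentIn (hypSpace n \ minkMirrors W) x₀) ∩ hypSpace n)
    (hDcpt : IsCompact D)
    (hcover : ∀ x ∈ hypSpace n, ∃ w ∈ W, ∃ d ∈ D, w d = x)
    (hC : C = {v : Fin (n + 1) → ℝ | ∃ t : ℝ, 0 ≤ t ∧ ∃ d ∈ D, v = t • d})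
    (hdisj : ∀ w ∈ W, ∀ w' ∈ W, w ≠ w' →
      ∀ x ∈ interior C, ∀ x' ∈ interior C, w x ≠ w' x') :
    (∀ w ∈ W, ∀ x ∈ interior C,
      -x - w x ∈ {u : Fin (n + 1) → ℝ | mink u u < 0 ∧ u 0 < 0}) ∧
    (∀ u ∈ {u : Fin (n + 1) → ℝ | mink u u < 0 ∧ u 0 < 0},
      ∃ w ∈ W, ∃ x ∈ interior C, u = -x - w x) ∧
    (∀ w ∈ W, ∀ w' ∈ W, w ≠ w' →
      Disjoint {u : Fin (n + 1) → ℝ | ∃ x ∈ interior C, u = -x - w x}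
        {u : Fin (n + 1) → ℝ | ∃ x ∈ interior C, u = -x - w' x}) := by
  obtain ⟨x₀, ⟨hx, hx₀⟩, hD⟩ := hD
  rw [D_eq hx hx₀] at hD
  have hPD : PD W := hpd
  have hO : IsOpen (Om W x₀) := isOpen_Om hPD
  have hint : interior C = Om W x₀ := by
    apply Set.Subset.antisymm
    · exact interior_sub (fun v hv => C_eq hD hC hv)
    · exact interior_maximal (fun v hv => Cp_sub_C hD hC (Om_Cp hv)) hO
  rw [hint] at hdisj ⊢
  have hdisj1 : ∀ w ∈ W, w ≠ 1 → ∀ x ∈ Om W x₀, ∀ x' ∈ Om W x₀, w x ≠ x' :=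
    fun w hw h1 x hx x' hx' => hdisj w hw 1 W.one_mem h1 x hx x' hx'
  have hCham : Cham W (Cp W x₀) := mkCham hform hHinv hPD hx hx₀ hdisj1 (hD ▸ hDcpt)
    (hD ▸ hcover)
  have hintCp : interior (Cp W x₀) ⊆ Om W x₀ := interior_sub fun v hv => Or.inr hv
  refine ⟨?_, ?_, ?_⟩
  · intro w hw x hxO
    have h := Tm_add hxO.1 (W_Tm hHinv hw hxO.1)
    have h1 : -x - w x = -(x + w x) := by abel
    rw [h1]
    refine ⟨?_, ?_⟩
    · rw [mink_neg_left, mink_neg_right, neg_neg]; exact h.1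
    · have := h.2
      change -((x + w x) 0) < 0
      linarith
  · rintro u ⟨hu1, hu2⟩
    have huT : -u ∈ Tm n := by
      refine ⟨?_, ?_⟩
      · rw [mink_neg_left, mink_neg_right, neg_neg]; exact hu1
      · change 0 < -(u 0)
        linarith
    have huh := nrm_mem huT
    obtain ⟨x, hxi, w, hw, hwx⟩ := hCham.exists_free (sg (nrm (-u))) (sg_form huh.1) (sg_hyp huh)
    have hxO := hintCp hxi
    have hneg := mink_neg_of_Tm hxO.1 (hyp_sub_Tm huh)
    have hc := nrm_pos huT.1.ne
    set c := (√|mink (-u) (-u)|)⁻¹ with hcdef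
    set m := mink x (nrm (-u)) with hm
    have hwx' : w x = -x - (2 * m) • (c • (-u)) := hwx
    have ha : 0 < -(2 * m * c) := by nlinarith [mul_pos (neg_pos.2 hneg) hc]
    refine ⟨w, hw, (-(2 * m * c))⁻¹ • x, Om_smul hxO (inv_pos.2 ha), ?_⟩
    have h1 : -x - w x = (-(2 * m * c)) • u := by rw [hwx']; module
    have h2 : -((-(2 * m * c))⁻¹ • x) - w ((-(2 * m * c))⁻¹ • x)
        = (-(2 * m * c))⁻¹ • (-x - w x) := by
      rw [map_smul]; module
    rw [h2, h1, smul_smul, inv_mul_cancel₀ ha.ne', one_smul]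
  · intro w hw w' hw' hne
    rw [Set.disjoint_left]
    rintro u ⟨x, hxO, hux⟩ ⟨y, hyO, huy⟩
    have h1 : x - y = w' y - w x := by
      have h := hux.symm.trans huy
      have : x + w x = y + w' y := by
        have h' := congrArg Neg.neg h
        simp only [neg_sub, sub_neg_eq_add] at h'
        rw [add_comm x, add_comm y]; exact h'
      rw [sub_eq_sub_iff_add_eq_add, this]; abel
    have h2 : mink (x - y) (x - y) = mink (w' y - w x) (w' y - w x) := by rw [h1]
    simp only [mink_sub_left, mink_sub_right, hform w hw, hform w' hw', mink_comm y x,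
      mink_comm (w' y) (w x)] at h2
    have h3 : mink x ((w⁻¹ * w') y) = mink (w x) (w' y) := by
      rw [← hform w hw x]
      change mink (w x) (w (w⁻¹ (w' y))) = _
      rw [app_inv]
    have h4 := strict_fold hform hHinv hPD hx₀ hdisj1 hxO hyO
      (W.mul_mem (W.inv_mem hw) hw') (fun h => hne (inv_mul_eq_one.1 h))
    rw [h3] at h4
    linarith
end
end

section
/- Let n = dim V and suppose w = w'·w̃ ∈ W_reg with w', w̃ ∈ W. If dim span(C_{w'}) < n and the cone C_{w'} is adjacent to C_w, in the sense that dim span(C_{w'}) = dim span(C_{w'} ∩ C_w), then rank(1 − w') + rank(1 − w̃) = n, where rank denotes the dimension of the image of the linear map. -/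
open scoped RealInnerProductSpace

noncomputable section

/-- `g` is the orthogonal reflection in the linear hyperplane orthogonal to some
nonzero vector `u`. -/
def IsLinRefl {V : Type*} [NormedAddCommGroup V] [InnerProductSpace ℝ V]
    (g : V ≃ₗᵢ[ℝ] V) : Prop :=
  ∃ u : V, u ≠ 0 ∧ ∀ x : V, g x = x - ((2 * ⟪x, u⟫) / ⟪u, u⟫) • u

/-- The union of the reflection hyperplanes (mirrors) of the reflections belonging to `W`;
the mirror of a reflection is exactly its set of fixed points. -/
def mirrors {V : Type*} [NormedAddCommGroup V] [InnerProductSpace ℝ V]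
    (W : Subgroup (V ≃ₗᵢ[ℝ] V)) : Set V :=
  ⋃ g ∈ {g : V ≃ₗᵢ[ℝ] V | g ∈ W ∧ IsLinRefl g}, {x : V | g x = x}

/-- `C` is a fundamental chamber for `W`: the closure of a connected component of the
complement of the union of the reflection hyperplanes of `W`. -/
def IsChamber {V : Type*} [NormedAddCommGroup V] [InnerProductSpace ℝ V]
    (W : Subgroup (V ≃ₗᵢ[ℝ] V)) (C : Set V) : Prop :=
  ∃ x₀ ∈ (mirrors W)ᶜ, C = closure (connectedComponentIn (mirrors W)ᶜ x₀)

/-- The endomorphism `1 - w` of `V`. -/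
def oneSub {V : Type*} [NormedAddCommGroup V] [InnerProductSpace ℝ V]
    (w : V ≃ₗᵢ[ℝ] V) : V →ₗ[ℝ] V :=
  LinearMap.id - (w.toLinearEquiv : V →ₗ[ℝ] V)

/-- `u` is a root of `W`. -/
def IsRt {V : Type*} [NormedAddCommGroup V] [InnerProductSpace ℝ V]
    (W : Subgroup (V ≃ₗᵢ[ℝ] V)) (u : V) : Prop :=
  u ≠ 0 ∧ ∃ g ∈ W, ∀ x : V, g x = x - ((2 * ⟪x, u⟫) / ⟪u, u⟫) • u

/-- Open sign cone of `x₀`. -/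
def PC {V : Type*} [NormedAddCommGroup V] [InnerProductSpace ℝ V]
    (W : Subgroup (V ≃ₗᵢ[ℝ] V)) (x₀ : V) : Set V :=
  {x | ∀ u, IsRt W u → 0 < ⟪x, u⟫ * ⟪x₀, u⟫}

/-- Closed sign cone of `x₀`. -/
def QC {V : Type*} [NormedAddCommGroup V] [InnerProductSpace ℝ V]
    (W : Subgroup (V ≃ₗᵢ[ℝ] V)) (x₀ : V) : Set V :=
  {x | ∀ u, IsRt W u → 0 ≤ ⟪x, u⟫ * ⟪x₀, u⟫}

section helpers

variable {V : Type*} [NormedAddCommGroup V] [InnerProductSpace ℝ V]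
  {W : Subgroup (V ≃ₗᵢ[ℝ] V)} {x₀ : V}

lemma PC_add_QC {x y : V} (hx : x ∈ PC W x₀) (hy : y ∈ QC W x₀) : y + x ∈ PC W x₀ := by
  intro u hu
  have h1 := hx u hu
  have h2 := hy u hu
  rw [inner_add_left]; linarith [add_mul ⟪y, u⟫ ⟪x, u⟫ ⟪x₀, u⟫]

lemma QC_add {x y : V} (hx : x ∈ QC W x₀) (hy : y ∈ QC W x₀) : x + y ∈ QC W x₀ := by
  intro u hu
  have h1 := hx u hu
  have h2 := hy u hu
  rw [inner_add_left]; linarith [add_mul ⟪x, u⟫ ⟪y, u⟫ ⟪x₀, u⟫]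

lemma QC_smul {x : V} (hx : x ∈ QC W x₀) {c : ℝ} (hc : 0 ≤ c) : c • x ∈ QC W x₀ := by
  intro u hu
  have h1 := hx u hu
  rw [real_inner_smul_left, mul_assoc]; exact mul_nonneg hc h1

lemma PC_smul {x : V} (hx : x ∈ PC W x₀) {c : ℝ} (hc : 0 < c) : c • x ∈ PC W x₀ := by
  intro u hu
  have h1 := hx u hu
  rw [real_inner_smul_left, mul_assoc]; exact mul_pos hc h1

lemma PC_sub_QC : PC W x₀ ⊆ QC W x₀ := fun _ hx u hu => (hx u hu).le

lemma root_ne (h : x₀ ∈ (mirrors W)ᶜ) {u : V} (hu : IsRt W u) : ⟪x₀, u⟫ ≠ 0 := by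
  intro h0
  obtain ⟨hu0, g, hg, hgu⟩ := hu
  apply h
  simp only [mirrors, Set.mem_iUnion]
  exact ⟨g, ⟨hg, u, hu0, hgu⟩, by simp [hgu, h0]⟩

lemma mem_PC_self (h : x₀ ∈ (mirrors W)ᶜ) : x₀ ∈ PC W x₀ := fun _ hu =>
  mul_self_pos.2 (root_ne h hu)

lemma PC_compl : PC W x₀ ⊆ (mirrors W)ᶜ := by
  intro x hx hm
  simp only [mirrors, Set.mem_iUnion] at hm
  obtain ⟨g, ⟨hg, u, hu0, hgu⟩, hfix⟩ := hm
  have h1 := hx u ⟨hu0, g, hg, hgu⟩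
  have h2 : g x = x := hfix
  rw [hgu, sub_eq_self, smul_eq_zero, or_iff_left hu0, div_eq_zero_iff] at h2
  have h3 : ⟪u, u⟫ ≠ 0 := by simpa using hu0
  have h4 : ⟪x, u⟫ = 0 := by
    rcases h2 with h | h
    · linarith
    · exact absurd h h3
  rw [h4] at h1; simp at h1

lemma PC_convex : Convex ℝ (PC W x₀) := by
  intro x hx y hy a b ha hb hab
  rcases ha.eq_or_lt with h | h
  · subst h
    have : b = 1 := by linarith
    subst this; simpa using hy
  · rw [add_comm]
    exact PC_add_QC (PC_smul hx h) (QC_smul (PC_sub_QC hy) hb)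

lemma PC_eq (h : x₀ ∈ (mirrors W)ᶜ) : connectedComponentIn (mirrors W)ᶜ x₀ = PC W x₀ := by
  apply Set.Subset.antisymm
  · intro x hx u hu
    by_contra hneg
    push Not at hneg
    have hpre : IsPreconnected (connectedComponentIn (mirrors W)ᶜ x₀) :=
      isPreconnected_connectedComponentIn
    have hc : ContinuousOn (fun y : V => ⟪y, u⟫ * ⟪x₀, u⟫)
        (connectedComponentIn (mirrors W)ᶜ x₀) := by fun_prop
    have := hpre.intermediate_value hx (mem_connectedComponentIn h) hc
    obtain ⟨y, hy, hy0⟩ := this ⟨hneg, (mem_PC_self h u hu).le⟩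
    have hy1 : y ∈ (mirrors W)ᶜ := connectedComponentIn_subset _ _ hy
    rcases mul_eq_zero.1 hy0 with h1 | h1
    · exact root_ne hy1 hu h1
    · exact root_ne h hu h1
  · exact PC_convex.isPreconnected.subset_connectedComponentIn (mem_PC_self h) PC_compl

lemma mirrors_closed (hWfin : (W : Set (V ≃ₗᵢ[ℝ] V)).Finite) : IsClosed (mirrors W) := by
  apply Set.Finite.isClosed_biUnion
  · exact hWfin.subset fun g hg => hg.1
  · intro g _
    exact isClosed_eq g.continuous continuous_id

lemma PC_open (hWfin : (W : Set (V ≃ₗᵢ[ℝ] V)).Finite) (h : x₀ ∈ (mirrors W)ᶜ) :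
    IsOpen (PC W x₀) := by
  rw [← PC_eq h]
  exact (mirrors_closed hWfin).isOpen_compl.connectedComponentIn

lemma closure_PC (h : x₀ ∈ (mirrors W)ᶜ) : closure (PC W x₀) = QC W x₀ := by
  apply Set.Subset.antisymm
  · apply closure_minimal PC_sub_QC
    simp only [QC, Set.ofPred_forall]
    refine isClosed_iInter fun u => isClosed_iInter fun _ => isClosed_le (by fun_prop) (by fun_prop)
  · intro v hv
    have hc : Continuous (fun t : ℝ => v + t • x₀) := by fun_prop
    have ht : Filter.Tendsto (fun t : ℝ => v + t • x₀) (nhdsWithin 0 (Set.Ioi 0)) (nhds v) := by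
      have := hc.tendsto 0
      simp only [zero_smul, add_zero] at this
      exact this.mono_left nhdsWithin_le_nhds
    apply mem_closure_of_tendsto ht
    filter_upwards [self_mem_nhdsWithin] with t htp
    exact PC_add_QC (PC_smul (mem_PC_self h) htp) hv

lemma max_mem_QC {x v : V} (hx : x ∈ PC W x₀)
    (hmax : ∀ g ∈ W, ⟪x, g v⟫ ≤ ⟪x, v⟫) : v ∈ QC W x₀ := by
  intro u hu
  have h1 := hx u hu
  obtain ⟨hu0, g, hg, hgu⟩ := hu
  have h2 := hmax g hg
  rw [hgu, inner_sub_right, real_inner_smul_right] at h2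
  have h3 : 0 < ⟪u, u⟫ := real_inner_self_pos.2 hu0
  have h4 : 0 ≤ 2 * ⟪v, u⟫ / ⟪u, u⟫ * ⟪x, u⟫ := by linarith
  have h5 : 0 ≤ ⟪v, u⟫ * ⟪x, u⟫ := by
    have : 2 * ⟪v, u⟫ / ⟪u, u⟫ * ⟪x, u⟫ = (⟪v, u⟫ * ⟪x, u⟫) * (2 / ⟪u, u⟫) := by ring
    rw [this] at h4
    exact nonneg_of_mul_nonneg_left h4 (by positivity)
  by_contra hneg
  push Not at hneg
  have h6 := mul_neg_of_pos_of_neg h1 hneg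
  nlinarith [mul_nonneg h5 (mul_self_nonneg ⟪x₀, u⟫)]

lemma inner_le_PC (hWfin : (W : Set (V ≃ₗᵢ[ℝ] V)).Finite) (h : x₀ ∈ (mirrors W)ᶜ)
    (hdisj : ∀ w ∈ W, ∀ w' ∈ W, w ≠ w' →
      ∀ x ∈ PC W x₀, ∀ x' ∈ PC W x₀, w x ≠ w' x')
    {x z : V} (hx : x ∈ PC W x₀) (hz : z ∈ PC W x₀) {g : V ≃ₗᵢ[ℝ] V} (hg : g ∈ W) :
    ⟪x, g z⟫ ≤ ⟪x, z⟫ := by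
  obtain ⟨m, hm, hmax⟩ := Set.exists_max_image (W : Set (V ≃ₗᵢ[ℝ] V)) (fun g => ⟪x, g z⟫)
    hWfin ⟨1, W.one_mem⟩
  have hmQ : m z ∈ QC W x₀ := max_mem_QC hx fun k hk => hmax (k * m) (W.mul_mem hk hm)
  rw [← closure_PC h] at hmQ
  have hopen : IsOpen (m '' PC W x₀) := m.toHomeomorph.isOpenMap _ (PC_open hWfin h)
  obtain ⟨y, ⟨z', hz', rfl⟩, hy⟩ := mem_closure_iff.1 hmQ _ hopen ⟨z, hz, rfl⟩
  have hm1 : m = 1 := by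
    by_contra hne
    exact hdisj m hm 1 W.one_mem hne z' hz' (m z') hy rfl
  subst hm1
  exact hmax g hg

lemma inner_le_QC (hWfin : (W : Set (V ≃ₗᵢ[ℝ] V)).Finite) (h : x₀ ∈ (mirrors W)ᶜ)
    (hdisj : ∀ w ∈ W, ∀ w' ∈ W, w ≠ w' →
      ∀ x ∈ PC W x₀, ∀ x' ∈ PC W x₀, w x ≠ w' x')
    {x z : V} (hx : x ∈ PC W x₀) (hz : z ∈ QC W x₀) {g : V ≃ₗᵢ[ℝ] V} (hg : g ∈ W) :
    ⟪x, g z⟫ ≤ ⟪x, z⟫ := by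
  rw [← closure_PC h] at hz
  have hcl : IsClosed {z : V | ⟪x, g z⟫ ≤ ⟪x, z⟫} := by
    have := g.continuous
    exact isClosed_le (by fun_prop) (by fun_prop)
  exact closure_minimal (fun z hz => inner_le_PC hWfin h hdisj hx hz hg) hcl hz

lemma fixed_of_inner_eq (hWfin : (W : Set (V ≃ₗᵢ[ℝ] V)).Finite) (h : x₀ ∈ (mirrors W)ᶜ)
    (hdisj : ∀ w ∈ W, ∀ w' ∈ W, w ≠ w' →
      ∀ x ∈ PC W x₀, ∀ x' ∈ PC W x₀, w x ≠ w' x')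
    {x z : V} (hx : x ∈ PC W x₀) (hz : z ∈ QC W x₀) {g : V ≃ₗᵢ[ℝ] V} (hg : g ∈ W)
    (he : ⟪x, g z⟫ = ⟪x, z⟫) : g z = z := by
  have hc : Continuous (fun t : ℝ => x + t • (g z - z)) := by fun_prop
  have hn : ∀ᶠ t in nhds (0 : ℝ), x + t • (g z - z) ∈ PC W x₀ :=
    hc.continuousAt.eventually_mem ((PC_open hWfin h).mem_nhds (by simpa using hx))
  obtain ⟨t, htP, ht⟩ := ((hn.filter_mono nhdsWithin_le_nhds).and
    (self_mem_nhdsWithin : Set.Ioi (0 : ℝ) ∈ nhdsWithin 0 (Set.Ioi 0))).exists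
  have h1 := inner_le_QC hWfin h hdisj htP hz hg
  rw [← sub_nonpos, ← inner_sub_right, inner_add_left, real_inner_smul_left, inner_sub_right x,
    he, sub_self, zero_add] at h1
  have ht' : 0 < t := ht
  have h2 : ⟪g z - z, g z - z⟫ ≤ 0 := by
    by_contra hh
    push Not at hh
    linarith [mul_pos ht' hh]
  exact sub_eq_zero.1 (real_inner_self_nonpos.1 h2)

lemma key_fixed (hWfin : (W : Set (V ≃ₗᵢ[ℝ] V)).Finite) (h : x₀ ∈ (mirrors W)ᶜ)
    (hdisj : ∀ w ∈ W, ∀ w' ∈ W, w ≠ w' →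
      ∀ x ∈ PC W x₀, ∀ x' ∈ PC W x₀, w x ≠ w' x')
    {x z : V} (hx : x ∈ PC W x₀) (hz : z ∈ QC W x₀) {w' wt : V ≃ₗᵢ[ℝ] V} (hg : wt ∈ W)
    (he : x - w' x = z - (w' * wt) z) : wt z = z := by
  apply fixed_of_inner_eq hWfin h hdisj hx hz hg
  have h1 : x - z = w' (x - wt z) := by
    rw [map_sub]
    have : (w' * wt) z = w' (wt z) := rfl
    rw [this] at he
    rw [sub_eq_sub_iff_add_eq_add] at he ⊢
    rw [he, add_comm]
  have h2 : ‖x - z‖ = ‖x - wt z‖ := by rw [h1, w'.norm_map]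
  have h3 := norm_sub_sq_real x z
  have h4 := norm_sub_sq_real x (wt z)
  rw [wt.norm_map] at h4
  rw [h2] at h3
  linarith

lemma span_diff {K : Set V} (h0 : (0 : V) ∈ K) (hadd : ∀ a ∈ K, ∀ b ∈ K, a + b ∈ K)
    (hsm : ∀ a ∈ K, ∀ c : ℝ, 0 ≤ c → c • a ∈ K) {v : V} (hv : v ∈ Submodule.span ℝ K) :
    ∃ a ∈ K, ∃ b ∈ K, v = a - b := by
  induction hv using Submodule.span_induction with
  | mem x hx => exact ⟨x, hx, 0, h0, by simp⟩
  | zero => exact ⟨0, h0, 0, h0, by simp⟩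
  | add x y _ _ hx hy =>
    obtain ⟨a, ha, b, hb, rfl⟩ := hx
    obtain ⟨a', ha', b', hb', rfl⟩ := hy
    exact ⟨a + a', hadd _ ha _ ha', b + b', hadd _ hb _ hb', by abel⟩
  | smul c x _ hx =>
    obtain ⟨a, ha, b, hb, rfl⟩ := hx
    rcases le_total 0 c with hc | hc
    · exact ⟨c • a, hsm _ ha _ hc, c • b, hsm _ hb _ hc, smul_sub _ _ _⟩
    · refine ⟨(-c) • b, hsm _ hb _ (by linarith), (-c) • a, hsm _ ha _ (by linarith), ?_⟩
      module

lemma oneSub_apply' (w : V ≃ₗᵢ[ℝ] V) (x : V) : oneSub w x = x - w x := rfl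

end helpers

/-- If `w = w' w̃ ∈ W_reg` and the cone `C_{w'}` of dimension `< n` is adjacent to `C_w`
(that is, `dim span C_{w'} = dim span (C_{w'} ∩ C_w)`), then
`rank (1 - w') + rank (1 - w̃) = n`. -/
theorem rank_add_rank_of_adjacent {V : Type*} [NormedAddCommGroup V] [InnerProductSpace ℝ V]
    [FiniteDimensional ℝ V]
    (W : Subgroup (V ≃ₗᵢ[ℝ] V)) (C : Set V)
    (hWfin : (W : Set (V ≃ₗᵢ[ℝ] V)).Finite)
    (hWgen : Subgroup.closure {g : V ≃ₗᵢ[ℝ] V | g ∈ W ∧ IsLinRefl g} = W)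
    (hC : IsChamber W C)
    (hcover : ∀ v : V, ∃ w ∈ W, ∃ x ∈ C, w x = v)
    (hdisj : ∀ w ∈ W, ∀ w' ∈ W, w ≠ w' →
      ∀ x ∈ interior C, ∀ x' ∈ interior C, w x ≠ w' x')
    (hess : ∀ v : V, (∀ w ∈ W, w v = v) → v = 0)
    (w' wt : V ≃ₗᵢ[ℝ] V) (hw' : w' ∈ W) (hwt : wt ∈ W)
    (hreg : ∀ x : V, (w' * wt) x = x → x = 0)
    (hdim : Module.finrank ℝ (Submodule.span ℝ {y : V | ∃ x ∈ C, y = x - w' x}) <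
      Module.finrank ℝ V)
    (hadj : Module.finrank ℝ (Submodule.span ℝ {y : V | ∃ x ∈ C, y = x - w' x}) =
      Module.finrank ℝ (Submodule.span ℝ
        ({y : V | ∃ x ∈ C, y = x - w' x} ∩ {y : V | ∃ x ∈ C, y = x - (w' * wt) x}))) :
    Module.finrank ℝ (LinearMap.range (oneSub w')) +
      Module.finrank ℝ (LinearMap.range (oneSub wt)) = Module.finrank ℝ V := by
  obtain ⟨x₀, h, hCe⟩ := hC
  have hPC : PC W x₀ ⊆ interior C := by
    rw [hCe, PC_eq h]
    exact interior_maximal subset_closure (PC_open hWfin h)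
  rw [PC_eq h, closure_PC h] at hCe
  have hdisj' : ∀ w ∈ W, ∀ w' ∈ W, w ≠ w' →
      ∀ x ∈ PC W x₀, ∀ x' ∈ PC W x₀, w x ≠ w' x' := fun w hw w' hw' hne x hx x' hx' =>
    hdisj w hw w' hw' hne x (hPC hx) x' (hPC hx')
  clear hdisj hcover hPC hdim
  subst hCe
  set A : Set V := {y : V | ∃ x ∈ QC W x₀, y = x - w' x} with hA
  set B : Set V := {y : V | ∃ x ∈ QC W x₀, y = x - (w' * wt) x} with hB
  have hx0 := mem_PC_self h
  have h0Q : (0 : V) ∈ QC W x₀ := by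
    intro u hu; simp
  -- cone structure, for any group element
  have cadd : ∀ (g : V ≃ₗᵢ[ℝ] V) (a b : V), (∃ x ∈ QC W x₀, a = x - g x) →
      (∃ x ∈ QC W x₀, b = x - g x) → ∃ x ∈ QC W x₀, a + b = x - g x := by
    rintro g _ _ ⟨x, hx, rfl⟩ ⟨y, hy, rfl⟩
    exact ⟨x + y, QC_add hx hy, by rw [map_add]; abel⟩
  have csm : ∀ (g : V ≃ₗᵢ[ℝ] V) (a : V) (c : ℝ), 0 ≤ c → (∃ x ∈ QC W x₀, a = x - g x) →
      ∃ x ∈ QC W x₀, c • a = x - g x := by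
    rintro g _ c hc ⟨x, hx, rfl⟩
    exact ⟨c • x, QC_smul hx hc, by rw [map_smul, smul_sub]⟩
  have c0 : ∀ (g : V ≃ₗᵢ[ℝ] V), ∃ x ∈ QC W x₀, (0 : V) = x - g x := fun g =>
    ⟨0, h0Q, by simp⟩
  have hKadd : ∀ a ∈ A ∩ B, ∀ b ∈ A ∩ B, a + b ∈ A ∩ B := fun a ha b hb =>
    ⟨cadd _ _ _ ha.1 hb.1, cadd _ _ _ ha.2 hb.2⟩
  have hKsm : ∀ a ∈ A ∩ B, ∀ c : ℝ, 0 ≤ c → c • a ∈ A ∩ B := fun a ha c hc =>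
    ⟨csm _ _ _ hc ha.1, csm _ _ _ hc ha.2⟩
  have hK0 : (0 : V) ∈ A ∩ B := ⟨c0 _, c0 _⟩
  have hspan : Submodule.span ℝ (A ∩ B) = Submodule.span ℝ A :=
    Submodule.eq_of_le_of_finrank_eq (Submodule.span_mono Set.inter_subset_left) hadj.symm
  set M : Submodule ℝ V := (LinearMap.ker (oneSub wt)).map (oneSub (w' * wt)) with hM
  have hint : ∀ x ∈ PC W x₀, x - w' x ∈ B → x - w' x ∈ M := by
    rintro x hx ⟨z, hz, he⟩
    have hf := key_fixed hWfin h hdisj' hx hz hwt he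
    exact ⟨z, by simp [oneSub_apply', hf], by rw [oneSub_apply', he]⟩
  have hx0A : x₀ - w' x₀ ∈ Submodule.span ℝ (A ∩ B) := by
    rw [hspan]; exact Submodule.subset_span ⟨x₀, PC_sub_QC hx0, rfl⟩
  obtain ⟨a, ha, b, hb, hab⟩ := span_diff hK0 hKadd hKsm hx0A
  obtain ⟨xb, hxb, hbe⟩ := hb.1
  have hplus : ∀ k ∈ A ∩ B, k + a ∈ M := by
    intro k hk
    obtain ⟨xk, hxk, hke⟩ := hk.1
    have he : k + a = ((xk + xb) + x₀) - w' ((xk + xb) + x₀) := by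
      have : a = (x₀ - w' x₀) + b := by rw [hab]; abel
      rw [this, hke, hbe, map_add, map_add]; abel
    rw [he]
    apply hint _ (PC_add_QC hx0 (QC_add hxk hxb))
    rw [← he]
    exact (hKadd _ hk _ ha).2
  have haM : a ∈ M := by simpa using hplus 0 hK0
  have hKM : Submodule.span ℝ (A ∩ B) ≤ M := Submodule.span_le.2 fun k hk => by
    have := M.sub_mem (hplus k hk) haM
    simpa using this
  -- range of 1 - w' is contained in M
  have hrange : LinearMap.range (oneSub w') ≤ M := by
    refine le_trans ?_ (hspan ▸ hKM)
    rintro _ ⟨v, rfl⟩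
    have hPo := PC_open hWfin h
    have hc : Continuous (fun t : ℝ => x₀ + t • v) := by fun_prop
    have hn : ∀ᶠ t in nhds (0 : ℝ), x₀ + t • v ∈ PC W x₀ :=
      hc.continuousAt.eventually_mem (hPo.mem_nhds (by simpa using hx0))
    obtain ⟨t, htP, ht⟩ := ((hn.filter_mono nhdsWithin_le_nhds).and
      (self_mem_nhdsWithin : Set.Ioi (0 : ℝ) ∈ nhdsWithin 0 (Set.Ioi 0))).exists
    have ht' : (0 : ℝ) < t := ht
    have h1 : oneSub w' (x₀ + t • v) ∈ Submodule.span ℝ A :=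
      Submodule.subset_span ⟨_, PC_sub_QC htP, rfl⟩
    have h2 : oneSub w' x₀ ∈ Submodule.span ℝ A :=
      Submodule.subset_span ⟨_, PC_sub_QC hx0, rfl⟩
    have h3 := Submodule.sub_mem _ h1 h2
    rw [map_add, add_sub_cancel_left, map_smul] at h3
    exact (Submodule.smul_mem_iff _ ht'.ne').1 h3
  have hle : Module.finrank ℝ (LinearMap.range (oneSub w')) ≤
      Module.finrank ℝ (LinearMap.ker (oneSub wt)) :=
    (Submodule.finrank_mono hrange).trans (Submodule.finrank_map_le _ _)
  have hdis : LinearMap.ker (oneSub w') ⊓ LinearMap.ker (oneSub wt) = ⊥ := by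
    rw [eq_bot_iff]
    rintro x ⟨hx1, hx2⟩
    have e1 : w' x = x := (sub_eq_zero.1 (show x - w' x = 0 from hx1)).symm
    have e2 : wt x = x := (sub_eq_zero.1 (show x - wt x = 0 from hx2)).symm
    exact hreg x (by rw [show (w' * wt) x = w' (wt x) from rfl, e2, e1])
  have hsum := Submodule.finrank_sup_add_finrank_inf_eq
    (LinearMap.ker (oneSub w')) (LinearMap.ker (oneSub wt))
  rw [hdis, finrank_bot] at hsum
  have hsup := Submodule.finrank_le (LinearMap.ker (oneSub w') ⊔ LinearMap.ker (oneSub wt))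
  have r1 := LinearMap.finrank_range_add_finrank_ker (oneSub w')
  have r2 := LinearMap.finrank_range_add_finrank_ker (oneSub wt)
  omega
end
end

section
/- (Kostant) Let w = s_{u₁} s_{u₂} ⋯ s_{u_k} with u₁, …, u_k ∈ R. Then the following are equivalent: (i) rank(1 − w) = k; (ii) the decomposition is of minimal length, i.e. w cannot be written as a product of fewer than k reflections s_u with u ∈ R; (iii) the vectors u₁, …, u_k are linearly independent. -/
open scoped RealInnerProductSpace

noncomputable section

/-- `R`: the set of unit vectors `u` such that the orthogonal reflection in the hyperplane
`u^⊥` belongs to `W`. -/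
def unitReflVecs {V : Type*} [NormedAddCommGroup V] [InnerProductSpace ℝ V]
    (W : Subgroup (V ≃ₗᵢ[ℝ] V)) : Set V :=
  {u : V | ‖u‖ = 1 ∧ ∃ g ∈ W, ∀ x : V, g x = x - (2 * ⟪x, u⟫) • u}

namespace Kostant

variable {V : Type*} [NormedAddCommGroup V] [InnerProductSpace ℝ V]

/-- Reflection in the hyperplane orthogonal to `a`. -/
def refl (a : V) : V ≃ₗᵢ[ℝ] V := (ℝ ∙ a)ᗮ.reflection

lemma refl_apply {a : V} (ha : ‖a‖ = 1) (x : V) : refl a x = x - (2 * ⟪x, a⟫) • a := by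
  unfold refl
  rw [Submodule.reflection_orthogonal_apply, Submodule.reflection_singleton_apply]
  simp [ha, real_inner_comm, two_smul, two_mul, add_smul]

lemma eq_refl {a : V} (ha : ‖a‖ = 1) {g : V ≃ₗᵢ[ℝ] V}
    (h : ∀ x, g x = x - (2 * ⟪x, a⟫) • a) : g = refl a := by
  ext x; rw [h, refl_apply ha]

lemma refl_mul_self (a : V) : refl a * refl a = 1 :=
  Submodule.reflection_mul_reflection _

lemma refl_self (a : V) : refl a a = -a :=
  Submodule.reflection_orthogonalComplement_singleton_eq_neg a

lemma inner_self_one {a : V} (ha : ‖a‖ = 1) : ⟪a, a⟫ = (1 : ℝ) := by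
  rw [real_inner_self_eq_norm_sq, ha]; norm_num

lemma refl_conj {a : V} (ha : ‖a‖ = 1) (g : V ≃ₗᵢ[ℝ] V) : refl (g a) * g = g * refl a := by
  have hga : ‖g a‖ = 1 := by simpa using ha
  ext x
  simp [refl_apply hga, refl_apply ha]

lemma mem_R {W : Subgroup (V ≃ₗᵢ[ℝ] V)} {a : V} :
    a ∈ unitReflVecs W ↔ ‖a‖ = 1 ∧ refl a ∈ W := by
  constructor
  · rintro ⟨h, g, hg, hx⟩
    exact ⟨h, eq_refl h hx ▸ hg⟩
  · rintro ⟨h, hg⟩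
    exact ⟨h, _, hg, refl_apply h⟩

lemma R_map {W : Subgroup (V ≃ₗᵢ[ℝ] V)} {a : V} (ha : a ∈ unitReflVecs W)
    {g : V ≃ₗᵢ[ℝ] V} (hg : g ∈ W) : g a ∈ unitReflVecs W := by
  rw [mem_R] at *
  refine ⟨by simpa using ha.1, ?_⟩
  have := refl_conj ha.1 g
  rw [eq_mul_inv_of_mul_eq this]
  exact W.mul_mem (W.mul_mem hg ha.2) (W.inv_mem hg)

lemma R_neg {W : Subgroup (V ≃ₗᵢ[ℝ] V)} {a : V} (ha : a ∈ unitReflVecs W) :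
    -a ∈ unitReflVecs W := by
  rw [← refl_self]
  exact R_map ha (mem_R.1 ha).2

/-- Positive roots with respect to `x`. -/
def Pos (W : Subgroup (V ≃ₗᵢ[ℝ] V)) (x : V) : Set V := {a | a ∈ unitReflVecs W ∧ 0 < ⟪a, x⟫}

/-- Simple roots: positive ones whose reflection preserves the other positive roots. -/
def Simp (W : Subgroup (V ≃ₗᵢ[ℝ] V)) (x : V) : Set V :=
  {a | a ∈ Pos W x ∧ ∀ b ∈ Pos W x, b ≠ a → refl a b ∈ Pos W x}

lemma refl_inj {a b x : V} (ha : ‖a‖ = 1) (hb : ‖b‖ = 1) (hax : 0 < ⟪a, x⟫) (hbx : 0 < ⟪b, x⟫)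
    (h : refl a = refl b) : a = b := by
  have h1 : refl b a = -a := by rw [← h, refl_self]
  rw [refl_apply hb] at h1
  have h2 : a = ⟪a, b⟫ • b := by
    have : (2 : ℝ) • a = (2 : ℝ) • (⟪a, b⟫ • b) := by
      rw [smul_smul, two_smul]
      rw [sub_eq_iff_eq_add] at h1
      nth_rewrite 1 [h1]
      abel
    exact smul_right_injective V (two_ne_zero) this
  have h3 : |⟪a, b⟫| = 1 := by
    have := congrArg norm h2
    rw [norm_smul, ha, hb] at this
    simpa using this.symm
  have h4 : 0 < ⟪a, b⟫ := by
    have : ⟪a, x⟫ = ⟪a, b⟫ * ⟪b, x⟫ := by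
      conv_lhs => rw [h2]
      rw [real_inner_smul_left]
    rw [this] at hax
    exact (mul_pos_iff_of_pos_right hbx).1 hax
  rw [abs_of_pos h4] at h3
  rw [h2, h3, one_smul]

lemma Pos_finite {W : Subgroup (V ≃ₗᵢ[ℝ] V)} (hW : (W : Set (V ≃ₗᵢ[ℝ] V)).Finite) (x : V) :
    (Pos W x).Finite := by
  refine Set.Finite.of_finite_image (f := refl) (hW.subset ?_) ?_
  · rintro _ ⟨a, ha, rfl⟩
    exact (mem_R.1 ha.1).2
  · intro a ha b hb h
    exact refl_inj (mem_R.1 ha.1).1 (mem_R.1 hb.1).1 ha.2 hb.2 h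

/-- the subgroup generated by the simple reflections -/
def WS (W : Subgroup (V ≃ₗᵢ[ℝ] V)) (x : V) : Subgroup (V ≃ₗᵢ[ℝ] V) :=
  Subgroup.closure (refl '' Simp W x)

lemma refl_neg (a : V) : refl (-a) = refl a := by
  unfold refl
  have : (ℝ ∙ (-a)) = (ℝ ∙ a) := by
    rw [← Set.neg_singleton, Submodule.span_neg]
  simp only [this]

lemma pos_refl_mem {W : Subgroup (V ≃ₗᵢ[ℝ] V)} (hW : (W : Set (V ≃ₗᵢ[ℝ] V)).Finite) {x : V}
    (hx : ∀ r ∈ unitReflVecs W, ⟪r, x⟫ ≠ 0) {r : V} (hr : r ∈ Pos W x) :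
    refl r ∈ WS W x := by
  by_contra hcon
  obtain ⟨r, ⟨hr, hrn⟩, hmin⟩ := Set.exists_min_image {r | r ∈ Pos W x ∧ refl r ∉ WS W x}
    (fun r => ⟪r, x⟫) ((Pos_finite hW x).subset fun _ h => h.1) ⟨r, hr, hcon⟩
  have hlow : ∀ b ∈ Pos W x, ⟪b, x⟫ < ⟪r, x⟫ → refl b ∈ WS W x := by
    intro b hb hlt
    by_contra h
    exact absurd (hmin b ⟨hb, h⟩) (not_le.2 hlt)
  have hr1 := (mem_R.1 hr.1).1
  have hns : r ∉ Simp W x := fun h => hrn (Subgroup.subset_closure ⟨r, h, rfl⟩)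
  have hlowR : ∀ d ∈ unitReflVecs W, |⟪d, x⟫| < ⟪r, x⟫ → refl d ∈ WS W x := by
    intro d hd hlt
    rcases lt_or_gt_of_ne (hx d hd) with h | h
    · rw [← refl_neg]
      refine hlow _ ⟨R_neg hd, by rw [inner_neg_left]; linarith⟩ ?_
      rw [inner_neg_left]; rwa [abs_of_neg h] at hlt
    · exact hlow _ ⟨hd, h⟩ ((le_abs_self _).trans_lt hlt)
  -- a lower positive root with positive inner product yields the result
  have key : ∀ b ∈ Pos W x, ⟪b, x⟫ < ⟪r, x⟫ → 0 < ⟪r, b⟫ → False := by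
    intro b hb hlt hp
    have hb1 := (mem_R.1 hb.1).1
    have hle : ⟪r, b⟫ ≤ 1 := by
      have := real_inner_le_norm r b
      rwa [hr1, hb1, one_mul] at this
    have hbW := hlow b hb hlt
    have hdR := R_map hr.1 (mem_R.1 hb.1).2
    have hd : refl (refl b r) ∈ WS W x := by
      refine hlowR _ hdR ?_
      rw [refl_apply hb1, inner_sub_left, real_inner_smul_left, abs_lt]
      have h1 := hb.2
      have h2 := hr.2
      constructor <;> nlinarith [mul_pos hp h1, mul_le_mul_of_nonneg_right hle h1.le]
    apply hrn
    have := refl_conj hr1 (refl b)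
    have e : refl r = (refl b)⁻¹ * (refl (refl b r) * refl b) := by
      rw [this]; group
    rw [e]
    exact mul_mem (inv_mem hbW) (mul_mem hd hbW)
  simp only [Simp, Set.mem_ofPred_eq, not_and, not_forall] at hns
  obtain ⟨b, hb, hbr, hnp⟩ := hns hr
  have hb1 := (mem_R.1 hb.1).1
  have hsR := R_map hb.1 (mem_R.1 hr.1).2
  have hneg : ⟪refl r b, x⟫ < 0 :=
    lt_of_le_of_ne (not_lt.1 fun h => hnp ⟨hsR, h⟩) (hx _ hsR)
  have hc : -(refl r b) ∈ Pos W x := ⟨R_neg hsR, by rw [inner_neg_left]; linarith⟩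
  have hne := hneg
  rw [refl_apply hr1, inner_sub_left, real_inner_smul_left] at hne
  have hbp : 0 < ⟪b, r⟫ := by
    by_contra h
    push Not at h
    nlinarith [hb.2, hr.2]
  have hlt1 : ⟪b, r⟫ < 1 := by
    refine lt_of_le_of_ne ?_ ?_
    · have := real_inner_le_norm b r
      rwa [hr1, hb1, one_mul] at this
    · intro h
      exact hbr ((inner_eq_one_iff_of_norm_eq_one hb1 hr1).1 h)
  by_cases hbl : ⟪b, x⟫ < ⟪r, x⟫
  · exact key b hb hbl (by rwa [real_inner_comm])
  · refine key _ hc ?_ ?_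
    · rw [inner_neg_left, refl_apply hr1, inner_sub_left, real_inner_smul_left]
      nlinarith [hr.2]
    · rw [inner_neg_right, refl_apply hr1, inner_sub_right, real_inner_smul_right,
        inner_self_one hr1, real_inner_comm]
      linarith

lemma exchange {W : Subgroup (V ≃ₗᵢ[ℝ] V)} {x : V}
    (hx : ∀ r ∈ unitReflVecs W, ⟪r, x⟫ ≠ 0) {a : V} (ha : a ∈ Simp W x) (L : List V)
    (hL : ∀ b ∈ L, b ∈ Simp W x) (h : ⟪(L.map refl).prod a, x⟫ < 0) :
    ∃ L' : List V, (∀ b ∈ L', b ∈ Simp W x) ∧ L'.length + 1 = L.length ∧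
      (L'.map refl).prod = (L.map refl).prod * refl a := by
  have ha1 := (mem_R.1 ha.1.1).1
  induction L with
  | nil =>
    have := ha.1.2
    simp at h
    linarith
  | cons b L ih =>
    have hL' : ∀ c ∈ L, c ∈ Simp W x := fun c hc => hL c (List.mem_cons_of_mem _ hc)
    have hb := hL b List.mem_cons_self
    have hPW : (L.map refl).prod ∈ W := by
      refine Subgroup.list_prod_mem _ ?_
      intro g hg
      obtain ⟨c, hc, rfl⟩ := List.mem_map.1 hg
      exact (mem_R.1 (hL' c hc).1.1).2
    have hR := R_map ha.1.1 hPW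
    rcases lt_or_gt_of_ne (hx _ hR) with h1 | h1
    · obtain ⟨L', h2, h3, h4⟩ := ih hL' h1
      refine ⟨b :: L', ?_, by simp [h3], by simp [h4, mul_assoc]⟩
      intro c hc
      rcases List.mem_cons.1 hc with rfl | hc
      · exact hb
      · exact h2 c hc
    · have he : (L.map refl).prod a = b := by
        by_contra hne
        have := (hb.2 _ ⟨hR, h1⟩ hne).2
        simp at h
        linarith
      refine ⟨L, hL', by simp, ?_⟩
      have := refl_conj ha1 (L.map refl).prod
      rw [he] at this
      simp only [List.map_cons, List.prod_cons]
      rw [this, mul_assoc, refl_mul_self, mul_one]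

lemma free_word {W : Subgroup (V ≃ₗᵢ[ℝ] V)} {x : V}
    (hx : ∀ r ∈ unitReflVecs W, ⟪r, x⟫ ≠ 0) (n : ℕ) : ∀ (L : List V), L.length ≤ n →
    (∀ b ∈ L, b ∈ Simp W x) → (L.map refl).prod x = x → (L.map refl).prod = 1 := by
  induction n with
  | zero =>
    intro L hL _ _
    have : L = [] := List.length_eq_zero_iff.1 (by omega)
    simp [this]
  | succ n ih =>
    intro L hLn hL hfix
    rcases List.eq_nil_or_concat L with rfl | ⟨L0, a, rfl⟩
    · simp
    have ha : a ∈ Simp W x := hL a (by simp)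
    have hL0 : ∀ b ∈ L0, b ∈ Simp W x := fun b hb => hL b (by simp [hb])
    simp only [List.concat_eq_append, List.map_append, List.prod_append, List.map_cons,
      List.map_nil, List.prod_cons, List.prod_nil, mul_one] at hfix ⊢
    have hneg : ⟪(L0.map refl).prod a, x⟫ < 0 := by
      have h1 : ⟪((L0.map refl).prod * refl a) a, ((L0.map refl).prod * refl a) x⟫ = ⟪a, x⟫ :=
        LinearIsometryEquiv.inner_map_map _ _ _
      rw [hfix] at h1
      have h2 : ((L0.map refl).prod * refl a) a = - (L0.map refl).prod a := by
        rw [LinearIsometryEquiv.coe_mul, Function.comp_apply, refl_self, map_neg]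
      rw [h2, inner_neg_left] at h1
      have := ha.1.2
      linarith
    obtain ⟨L', h2, h3, h4⟩ := exchange hx ha L0 hL0 hneg
    rw [← h4] at hfix ⊢
    refine ih L' ?_ h2 hfix
    simp at hLn
    omega

lemma le_WS {W : Subgroup (V ≃ₗᵢ[ℝ] V)} (hW : (W : Set (V ≃ₗᵢ[ℝ] V)).Finite)
    (hWgen : Subgroup.closure {g : V ≃ₗᵢ[ℝ] V | g ∈ W ∧ IsLinRefl g} = W) {x : V}
    (hx : ∀ r ∈ unitReflVecs W, ⟪r, x⟫ ≠ 0) : W ≤ WS W x := by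
  have h : Subgroup.closure {g : V ≃ₗᵢ[ℝ] V | g ∈ W ∧ IsLinRefl g} ≤ WS W x := by
    rw [Subgroup.closure_le]
    rintro g ⟨hg, v, hv, hgv⟩
    have hvn : ‖v‖ ≠ 0 := norm_ne_zero_iff.2 hv
    have hu : ‖(‖v‖⁻¹ • v)‖ = 1 := by
      rw [norm_smul]; simp [hvn]
    have hge : g = refl (‖v‖⁻¹ • v) := by
      refine eq_refl hu fun y => ?_
      rw [hgv, real_inner_smul_right, smul_smul, real_inner_self_eq_norm_sq]
      congr 2
      field_simp
    have hR : ‖v‖⁻¹ • v ∈ unitReflVecs W := mem_R.2 ⟨hu, hge ▸ hg⟩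
    rw [hge]
    rcases lt_or_gt_of_ne (hx _ hR) with h | h
    · rw [← refl_neg]
      exact pos_refl_mem hW hx ⟨R_neg hR, by rw [inner_neg_left]; linarith⟩
    · exact pos_refl_mem hW hx ⟨hR, h⟩
  rwa [hWgen] at h

lemma free {W : Subgroup (V ≃ₗᵢ[ℝ] V)} (hW : (W : Set (V ≃ₗᵢ[ℝ] V)).Finite)
    (hWgen : Subgroup.closure {g : V ≃ₗᵢ[ℝ] V | g ∈ W ∧ IsLinRefl g} = W) {x : V}
    (hx : ∀ r ∈ unitReflVecs W, ⟪r, x⟫ ≠ 0) {w : V ≃ₗᵢ[ℝ] V} (hw : w ∈ W) (hfix : w x = x) :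
    w = 1 := by
  have h := le_WS hW hWgen hx hw
  have : ∃ L : List V, (∀ b ∈ L, b ∈ Simp W x) ∧ (L.map refl).prod = w := by
    refine Subgroup.closure_induction (p := fun w _ => ∃ L : List V, (∀ b ∈ L, b ∈ Simp W x) ∧
      (L.map refl).prod = w) ?_ ?_ ?_ ?_ h
    · rintro _ ⟨a, ha, rfl⟩
      exact ⟨[a], by simpa using ha, by simp⟩
    · exact ⟨[], by simp, by simp⟩
    · rintro _ _ _ _ ⟨L, hL, rfl⟩ ⟨M, hM, rfl⟩
      refine ⟨L ++ M, ?_, by simp⟩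
      intro b hb
      rcases List.mem_append.1 hb with hb | hb
      · exact hL b hb
      · exact hM b hb
    · rintro _ _ ⟨L, hL, rfl⟩
      refine ⟨L.reverse, by simpa using hL, ?_⟩
      rw [List.prod_inv_reverse, List.map_map, List.map_reverse]
      congr 2
  obtain ⟨L, hL, rfl⟩ := this
  exact free_word hx _ L le_rfl hL hfix

lemma mem_ker {w : V ≃ₗᵢ[ℝ] V} {y : V} : y ∈ LinearMap.ker (oneSub w) ↔ w y = y := by
  have : oneSub w y = y - w y := rfl
  rw [LinearMap.mem_ker, this, sub_eq_zero, eq_comm]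

lemma exists_root {W : Subgroup (V ≃ₗᵢ[ℝ] V)} (hW : (W : Set (V ≃ₗᵢ[ℝ] V)).Finite)
    (hWgen : Subgroup.closure {g : V ≃ₗᵢ[ℝ] V | g ∈ W ∧ IsLinRefl g} = W)
    {w : V ≃ₗᵢ[ℝ] V} (hw : w ∈ W) (hne : w ≠ 1) :
    ∃ r ∈ unitReflVecs W, ∀ y, w y = y → ⟪y, r⟫ = 0 := by
  by_contra! hcon
  apply hne
  let U := LinearMap.ker (oneSub w)
  let F : (V ≃ₗᵢ[ℝ] V) → Submodule ℝ U := fun g => (LinearMap.ker (oneSub g)).comap U.subtype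
  have hfin : (F '' (refl '' unitReflVecs W)).Finite := by
    refine Set.Finite.image _ (hW.subset ?_)
    rintro _ ⟨a, ha, rfl⟩
    exact (mem_R.1 ha).2
  have hker : ∀ r ∈ unitReflVecs W, ∀ y, refl r y = y ↔ ⟪y, r⟫ = 0 := by
    intro r hr y
    have h1 := (mem_R.1 hr).1
    have h0 : r ≠ 0 := by rintro rfl; simp at h1
    rw [refl_apply h1, sub_eq_self, smul_eq_zero]
    simp [h0]
  have htop : (⊤ : Submodule ℝ U) ∉ hfin.toFinset := by
    intro hmem
    rw [Set.Finite.mem_toFinset] at hmem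
    obtain ⟨_, ⟨r, hr, rfl⟩, h⟩ := hmem
    obtain ⟨y, hy, hyr⟩ := hcon r hr
    apply hyr
    rw [← hker r hr]
    have : (⟨y, mem_ker.2 hy⟩ : U) ∈ F (refl r) := by rw [h]; trivial
    exact mem_ker.1 this
  have := Subspace.biUnion_ne_univ_of_top_notMem htop
  obtain ⟨x, hx⟩ := (Set.ne_univ_iff_exists_notMem _).1 this
  refine free hW hWgen (x := x) ?_ hw (mem_ker.1 x.2)
  intro r hr h0
  apply hx
  simp only [Set.mem_iUnion]
  refine ⟨F (refl r), ?_, ?_⟩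
  · rw [Set.Finite.mem_toFinset]
    exact ⟨_, ⟨r, hr, rfl⟩, rfl⟩
  · refine mem_ker.2 ((hker r hr _).2 ?_)
    rw [real_inner_comm]; exact h0



lemma factor [FiniteDimensional ℝ V] {W : Subgroup (V ≃ₗᵢ[ℝ] V)} (hW : (W : Set (V ≃ₗᵢ[ℝ] V)).Finite)
    (hWgen : Subgroup.closure {g : V ≃ₗᵢ[ℝ] V | g ∈ W ∧ IsLinRefl g} = W) (n : ℕ) :
    ∀ w ∈ W, Module.finrank ℝ (LinearMap.range (oneSub w)) = n →
    ∃ L : List V, (∀ b ∈ L, b ∈ unitReflVecs W) ∧ L.length ≤ n ∧ (L.map refl).prod = w := by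
  induction n using Nat.strong_induction_on with
  | _ n ih =>
  intro w hw hn
  by_cases hne : w = 1
  · exact ⟨[], by simp, by simp, by simp [hne]⟩
  obtain ⟨r, hr, hperp⟩ := exists_root hW hWgen hw hne
  have hr1 := (mem_R.1 hr).1
  have hrange : r ∈ LinearMap.range (oneSub w) := by
    rw [← Submodule.orthogonal_orthogonal (LinearMap.range (oneSub w))]
    rw [Submodule.mem_orthogonal]
    intro y hy
    apply hperp
    rw [Submodule.mem_orthogonal'] at hy
    have h2 : ⟪y, y - w y⟫ = 0 := hy _ ⟨y, rfl⟩
    have h3 : ‖y - w y‖ ^ 2 = 0 := by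
      rw [inner_sub_right, real_inner_self_eq_norm_sq] at h2
      rw [norm_sub_sq_real, LinearIsometryEquiv.norm_map]
      linarith
    have h4 : y - w y = 0 := by simpa using h3
    exact (sub_eq_zero.1 h4).symm
  obtain ⟨v, hv⟩ := hrange
  have hv' : v - w v = r := hv
  have hrv : refl r (w v) = v := by
    have h1 : refl r v = w v := by
      rw [← hv']
      exact Submodule.reflection_sub (by simp)
    rw [← h1, ← Function.comp_apply (f := refl r), ← LinearIsometryEquiv.coe_mul, refl_mul_self]
    rfl
  have hlt : LinearMap.ker (oneSub w) < LinearMap.ker (oneSub (refl r * w)) := by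
    refine SetLike.lt_iff_le_and_exists.2 ⟨?_, v, ?_, ?_⟩
    · intro y hy
      rw [mem_ker] at hy ⊢
      rw [LinearIsometryEquiv.coe_mul, Function.comp_apply, hy, refl_apply hr1, hperp y hy]
      simp
    · rw [mem_ker]; exact hrv
    · rw [mem_ker]
      intro h
      rw [h, sub_self] at hv'
      rw [← hv'] at hr1
      simp at hr1
  have h1 := Submodule.finrank_lt_finrank_of_lt hlt
  have h2 := LinearMap.finrank_range_add_finrank_ker (oneSub w)
  have h3 := LinearMap.finrank_range_add_finrank_ker (oneSub (refl r * w))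
  obtain ⟨L, hL, hlen, hprod⟩ := ih _ (by omega) (refl r * w) (mul_mem (mem_R.1 hr).2 hw) rfl
  refine ⟨r :: L, ?_, ?_, ?_⟩
  · intro b hb
    rcases List.mem_cons.1 hb with rfl | hb
    · exact hr
    · exact hL b hb
  · simp; omega
  · simp only [List.map_cons, List.prod_cons]
    rw [hprod, ← mul_assoc, refl_mul_self, one_mul]


lemma sub_mem_span {k : ℕ} (u : Fin k → V) (hu : ∀ i, ‖u i‖ = 1) (y : V) :
    y - (List.ofFn fun i => refl (u i)).prod y ∈ Submodule.span ℝ (Set.range u) := by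
  induction k with
  | zero => simp
  | succ k ih =>
    have h := ih (fun i => u i.succ) (fun i => hu _)
    have hle : Submodule.span ℝ (Set.range fun i : Fin k => u i.succ) ≤
        Submodule.span ℝ (Set.range u) := by
      apply Submodule.span_mono
      rintro _ ⟨i, rfl⟩
      exact ⟨_, rfl⟩
    rw [List.ofFn_succ, List.prod_cons, LinearIsometryEquiv.coe_mul, Function.comp_apply,
      refl_apply (hu 0), ← sub_add]
    exact add_mem (hle h) (Submodule.smul_mem _ _ (Submodule.subset_span ⟨0, rfl⟩))


lemma fix_perp {k : ℕ} (u : Fin k → V) (hu : ∀ i, ‖u i‖ = 1) (hli : LinearIndependent ℝ u) (y : V)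
    (hy : (List.ofFn fun i => refl (u i)).prod y = y) : ∀ i, ⟪u i, y⟫ = 0 := by
  induction k with
  | zero => intro i; exact i.elim0
  | succ k ih =>
    rw [linearIndependent_finSucc] at hli
    have hm := sub_mem_span (fun i => u i.succ) (fun i => hu _) y
    rw [List.ofFn_succ, List.prod_cons, LinearIsometryEquiv.coe_mul, Function.comp_apply] at hy
    set z := (List.ofFn fun i : Fin k => refl (u i.succ)).prod y with hz
    have hzz : z - y = (2 * ⟪z, u 0⟫) • u 0 := by
      rw [refl_apply (hu 0)] at hy
      rw [sub_eq_iff_eq_add] at hy ⊢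
      rw [add_comm]; exact hy
    have hc : ⟪z, u 0⟫ = 0 := by
      by_contra hne
      apply hli.2
      have h1 : (2 * ⟪z, u 0⟫) • u 0 ∈ Submodule.span ℝ (Set.range (Fin.tail u)) := by
        rw [← hzz, ← neg_sub]
        exact neg_mem hm
      exact (Submodule.smul_mem_iff _ (mul_ne_zero two_ne_zero hne)).1 h1
    have hzy : z = y := by
      rw [hc] at hzz
      simpa [sub_eq_zero] using hzz
    intro i
    refine Fin.cases ?_ (fun j => ?_) i
    · rw [real_inner_comm, ← hzy]; exact hc
    · exact ih (fun i => u i.succ) (fun i => hu _) hli.1 hzy j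

end Kostant

/-- Kostant's theorem: for `w = s_{u₁} ⋯ s_{u_k}` with `u₁, …, u_k ∈ R` the following are
equivalent: (i) `rank (1 - w) = k`; (ii) the decomposition has minimal length;
(iii) `u₁, …, u_k` are linearly independent. -/
theorem kostant_minimal_decomposition {V : Type*} [NormedAddCommGroup V]
    [InnerProductSpace ℝ V] [FiniteDimensional ℝ V]
    (W : Subgroup (V ≃ₗᵢ[ℝ] V))
    (hWfin : (W : Set (V ≃ₗᵢ[ℝ] V)).Finite)
    (hWgen : Subgroup.closure {g : V ≃ₗᵢ[ℝ] V | g ∈ W ∧ IsLinRefl g} = W)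
    (k : ℕ) (u : Fin k → V) (hu : ∀ i, u i ∈ unitReflVecs W)
    (s : Fin k → (V ≃ₗᵢ[ℝ] V)) (hsW : ∀ i, s i ∈ W)
    (hs : ∀ i, ∀ x : V, s i x = x - (2 * ⟪x, u i⟫) • u i)
    (w : V ≃ₗᵢ[ℝ] V) (hw : w = (List.ofFn s).prod) :
    (Module.finrank ℝ (LinearMap.range (oneSub w)) = k ↔
      (∀ (m : ℕ) (r : Fin m → V) (t : Fin m → (V ≃ₗᵢ[ℝ] V)),
        (∀ i, r i ∈ unitReflVecs W) → (∀ i, t i ∈ W) →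
        (∀ i, ∀ x : V, t i x = x - (2 * ⟪x, r i⟫) • r i) →
        w = (List.ofFn t).prod → k ≤ m)) ∧
    (Module.finrank ℝ (LinearMap.range (oneSub w)) = k ↔ LinearIndependent ℝ u) := by
  have hu1 : ∀ i, ‖u i‖ = 1 := fun i => (hu i).1
  obtain rfl : s = fun i => Kostant.refl (u i) :=
    funext fun i => Kostant.eq_refl (hu1 i) (hs i)
  have hgen : ∀ (m : ℕ) (r : Fin m → V), (∀ i, ‖r i‖ = 1) →
      LinearMap.range (oneSub (List.ofFn fun i => Kostant.refl (r i)).prod) ≤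
        Submodule.span ℝ (Set.range r) := by
    rintro m r hr _ ⟨y, rfl⟩
    exact Kostant.sub_mem_span r hr y
  have hrank : ∀ (m : ℕ) (r : Fin m → V), (∀ i, ‖r i‖ = 1) →
      Module.finrank ℝ (LinearMap.range (oneSub (List.ofFn fun i => Kostant.refl (r i)).prod))
        ≤ m := by
    intro m r hr
    refine (Submodule.finrank_mono (hgen m r hr)).trans ?_
    simpa [Set.finrank] using finrank_range_le_card (R := ℝ) r
  have hwW : w ∈ W := by
    rw [hw]
    refine Subgroup.list_prod_mem _ ?_
    intro g hg
    obtain ⟨i, rfl⟩ := (List.mem_ofFn' _ _).1 hg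
    exact hsW i
  have hk : Module.finrank ℝ (LinearMap.range (oneSub w)) ≤ k := by
    rw [hw]; exact hrank k u hu1
  refine ⟨⟨?_, ?_⟩, ⟨?_, ?_⟩⟩
  · intro h m r t hr _ ht hwt
    obtain rfl : t = fun i => Kostant.refl (r i) :=
      funext fun i => Kostant.eq_refl (hr i).1 (ht i)
    rw [← h, hwt]
    exact hrank m r fun i => (hr i).1
  · intro h
    refine le_antisymm hk ?_
    obtain ⟨L, hL, hlen, hprod⟩ := Kostant.factor hWfin hWgen _ w hwW rfl
    refine le_trans (h L.length L.get (fun i => Kostant.refl (L.get i)) ?_ ?_ ?_ ?_) hlen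
    · intro i; exact hL _ (List.get_mem _ _)
    · intro i; exact (Kostant.mem_R.1 (hL _ (List.get_mem _ _))).2
    · intro i; exact Kostant.refl_apply (hL _ (List.get_mem _ _)).1
    · rw [← hprod]
      congr 1
      apply List.ext_get <;> simp
  · intro h
    rw [linearIndependent_iff_card_le_finrank_span, Fintype.card_fin]
    have := Submodule.finrank_mono (hgen k u hu1)
    rw [← hw, h] at this
    exact this
  · intro hli
    refine le_antisymm hk ?_
    have h1 : LinearMap.ker (oneSub w) ≤ (Submodule.span ℝ (Set.range u))ᗮ := by
      intro y hy
      rw [Kostant.mem_ker, hw] at hy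
      have h := Kostant.fix_perp u hu1 hli y hy
      have h2 : Submodule.span ℝ (Set.range u) ≤ (ℝ ∙ y)ᗮ := by
        rw [Submodule.span_le]
        rintro _ ⟨i, rfl⟩
        rw [SetLike.mem_coe, Submodule.mem_orthogonal_singleton_iff_inner_left]
        exact h i
      rw [Submodule.mem_orthogonal]
      intro z hz
      exact (Submodule.mem_orthogonal_singleton_iff_inner_left).1 (h2 hz)
    have h2 := Submodule.finrank_mono h1
    have h3 := LinearMap.finrank_range_add_finrank_ker (oneSub w)
    have h4 := Submodule.finrank_add_finrank_orthogonal (Submodule.span ℝ (Set.range u))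
    have h5 := finrank_span_eq_card hli
    rw [Fintype.card_fin] at h5
    omega
end
end
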